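/- arXiv:2007.13581 — 2 statements merged into one kernel-verified Lean document; each statement's English description precedes it below -/
import Mathlib

section
/- Let 1 < α < 2, T > 0 and θ ∈ (0, 1/(2α)). Let (λ_n) be a sequence of positive reals, and let (a_n), (b_n) be real sequences with Σ_n λ_n a_n² < ∞ and Σ_n b_n² < ∞. Then there exists C > 0 such that ∫_0^T Σ_{n=1}^∞ λ_n^{1+2θ} | a_n E_{α,1}(−λ_n t^α) + b_n t E_{α,2}(−λ_n t^α) |² dt ≤ C ( Σ_n λ_n a_n² + Σ_n b_n² ). (This is the spectral-coefficient form of the estimate ‖∇u‖_{L²(0,T;D(A^θ))} ≤ C(‖u₀‖_{H¹₀(Ω)} + ‖u₁‖_{L²(Ω)}).) -/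
open Complex Real MeasureTheory

/-- The Mittag–Leffler function `E_{α,β}(z) = Σ_{k=0}^∞ z^k / Γ(αk + β)`. -/
noncomputable def mittagLeffler (α β : ℝ) (z : ℂ) : ℂ :=
  ∑' k : ℕ, z ^ k / Complex.Gamma ((α * k + β : ℝ) : ℂ)

/-- Laplace transform of a power, on the open right half-plane. -/
theorem integral_rpow_mul_cexp_neg_mul_Ioi {p : ℝ} (hp : 0 < p) {s : ℂ} (hs : 0 < s.re) :
    ∫ t in Set.Ioi (0 : ℝ), ((t ^ (p - 1) : ℝ) : ℂ) * cexp (-(s * t))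
      = Real.Gamma p * s ^ (-p : ℂ) := by
  have hmeas : ∀ (q : ℝ) (z : ℂ), AEStronglyMeasurable
      (fun t : ℝ => ((t ^ q : ℝ) : ℂ) * cexp (-(z * t))) (volume.restrict (Set.Ioi 0)) := by
    intro q z
    apply Measurable.aestronglyMeasurable
    fun_prop
  have hre : ∀ q : ℝ, -1 < q → ∀ r : ℝ, 0 < r →
      IntegrableOn (fun t : ℝ => t ^ q * Real.exp (-r * t)) (Set.Ioi 0) := fun q hq r hr => by
    simpa using integrableOn_rpow_mul_exp_neg_mul_rpow (p := 1) hq one_pos hr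
  have hnorm : ∀ (q : ℝ) (z : ℂ), ∀ t ∈ Set.Ioi (0 : ℝ),
      ‖((t ^ q : ℝ) : ℂ) * cexp (-(z * t))‖ = t ^ q * Real.exp (-z.re * t) := by
    intro q z t ht
    rw [norm_mul, Complex.norm_exp, Complex.norm_real, Real.norm_of_nonneg
      (Real.rpow_nonneg (le_of_lt ht) _)]
    simp
  have hdiff : DifferentiableOn ℂ
      (fun s : ℂ => ∫ t in Set.Ioi (0 : ℝ), ((t ^ (p - 1) : ℝ) : ℂ) * cexp (-(s * t)))
      {s : ℂ | 0 < s.re} := by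
    intro z hz
    have hz' : 0 < z.re := hz
    refine (hasDerivAt_integral_of_dominated_loc_of_deriv_le
      (s := {w : ℂ | z.re / 2 < w.re})
      (F' := fun (w : ℂ) (t : ℝ) => -(((t ^ p : ℝ) : ℂ) * cexp (-(w * t))))
      (bound := fun t => t ^ p * Real.exp (-(z.re / 2) * t))
      ?_ ?_ ?_ ?_ ?_ ?_ ?_).2.differentiableAt.differentiableWithinAt
    · exact (isOpen_lt continuous_const Complex.continuous_re).mem_nhds
        (show z.re / 2 < z.re by linarith)
    · exact Filter.Eventually.of_forall fun w => hmeas _ _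
    · refine (hre (p - 1) (by linarith) z.re hz').mono' (hmeas _ _) ?_
      exact (ae_restrict_mem measurableSet_Ioi).mono fun t ht => (hnorm _ _ t ht).le
    · exact (hmeas _ _).neg
    · refine (ae_restrict_mem measurableSet_Ioi).mono fun t ht w hw => ?_
      rw [norm_neg, hnorm _ _ t ht]
      have ht' : 0 < t := ht
      have hw' : z.re / 2 < w.re := hw
      gcongr
    · exact hre p (by linarith) _ (by linarith)
    · refine (ae_restrict_mem measurableSet_Ioi).mono fun t ht w hw => ?_
      have h1 : HasDerivAt (fun w : ℂ => -(w * (t : ℂ))) (-(1 * (t : ℂ))) w :=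
        ((hasDerivAt_id w).mul_const (t : ℂ)).neg
      refine ((h1.cexp).const_mul ((t ^ (p - 1) : ℝ) : ℂ)).congr_deriv ?_
      have : t ^ p = t ^ (p - 1) * t := by
        rw [← Real.rpow_add_one (ne_of_gt ht)]; simp
      rw [this]; push_cast; ring
  have hopen : IsOpen {s : ℂ | 0 < s.re} := isOpen_lt continuous_const Complex.continuous_re
  have hdiff' : DifferentiableOn ℂ (fun s : ℂ => (Real.Gamma p : ℂ) * s ^ (-p : ℂ))
      {s : ℂ | 0 < s.re} := by
    intro z hz
    exact ((differentiableAt_id.cpow_const (Or.inl hz)).const_mul _).differentiableWithinAt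
  refine AnalyticOnNhd.eqOn_of_preconnected_of_frequently_eq (hdiff.analyticOnNhd hopen)
    (hdiff'.analyticOnNhd hopen) (convex_halfSpace_re_gt 0).isPreconnected
    (z₀ := 1) (by simp) ?_ hs
  have hreal : ∀ r : ℝ, 0 < r → ∫ t in Set.Ioi (0 : ℝ), ((t ^ (p - 1) : ℝ) : ℂ) *
      cexp (-((r : ℂ) * t)) = Real.Gamma p * (r : ℂ) ^ (-p : ℂ) := by
    intro r hr
    have h := Complex.integral_cpow_mul_exp_neg_mul_Ioi (a := p) (by simpa using hp) hr
    rw [one_div, Complex.inv_cpow _ _ (by rw [Complex.arg_ofReal_of_nonneg hr.le]; exact pi_ne_zero.symm),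
      ← Complex.cpow_neg, Complex.Gamma_ofReal, mul_comm] at h
    rw [← h]
    refine setIntegral_congr_fun measurableSet_Ioi fun t ht => ?_
    simp only [Complex.ofReal_cpow (le_of_lt ht), Complex.ofReal_sub, Complex.ofReal_one]
  have htend : Filter.Tendsto (fun r : ℝ => (r : ℂ)) (nhdsWithin 1 {1}ᶜ)
      (nhdsWithin 1 {1}ᶜ) := by
    refine tendsto_nhdsWithin_iff.2 ⟨?_, ?_⟩
    · exact (Complex.continuous_ofReal.tendsto' 1 1 (by simp)).mono_left nhdsWithin_le_nhds
    · filter_upwards [self_mem_nhdsWithin] with r hr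
      simpa using hr
  refine htend.frequently (Filter.Eventually.frequently ?_)
  filter_upwards [nhdsWithin_le_nhds (lt_mem_nhds (zero_lt_one (α := ℝ)))] with r hr
  exact hreal r hr

/-- The parametrisation `ξ ↦ 1 + 2πiξ` of the vertical line `Re s = 1`. -/
noncomputable def bromwichLine (ξ : ℝ) : ℂ := 1 + ((2 * π * ξ : ℝ) : ℂ) * I

theorem bromwichLine_re (ξ : ℝ) : (bromwichLine ξ).re = 1 := by simp [bromwichLine]

theorem bromwichLine_ne_zero (ξ : ℝ) : bromwichLine ξ ≠ 0 := fun h => by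
  simpa [h] using bromwichLine_re ξ

theorem one_le_norm_bromwichLine (ξ : ℝ) : 1 ≤ ‖bromwichLine ξ‖ := by
  simpa [bromwichLine_re] using Complex.abs_re_le_norm (bromwichLine ξ)

@[fun_prop]
theorem continuous_bromwichLine : Continuous bromwichLine := by
  unfold bromwichLine; fun_prop

theorem continuous_bromwichLine_cpow (p : ℂ) : Continuous fun ξ => bromwichLine ξ ^ p :=
  continuous_bromwichLine.cpow continuous_const fun ξ => Or.inl (by simp [bromwichLine_re])

theorem norm_cexp_bromwichLine (ξ : ℝ) : ‖cexp (bromwichLine ξ)‖ = Real.exp 1 := by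
  rw [Complex.norm_exp, bromwichLine_re]

theorem integrable_norm_bromwichLine_rpow {p : ℝ} (hp : 1 < p) :
    Integrable fun ξ : ℝ => ‖bromwichLine ξ‖ ^ (-p) := by
  refine ((integrable_one_add_norm (E := ℝ) (μ := volume) (r := p) (by simpa using hp)).const_mul
    (2 ^ p)).mono' ?_ (Filter.Eventually.of_forall fun ξ => ?_)
  · apply Measurable.aestronglyMeasurable
    have := continuous_bromwichLine.measurable
    fun_prop
  · rw [Real.norm_of_nonneg (by positivity)]
    have h1 := one_le_norm_bromwichLine ξ
    have h2 : |ξ| ≤ ‖bromwichLine ξ‖ := by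
      have h := Complex.abs_im_le_norm (bromwichLine ξ)
      have him : (bromwichLine ξ).im = 2 * π * ξ := by simp [bromwichLine]
      rw [him, abs_mul, abs_of_pos (by positivity)] at h
      nlinarith [abs_nonneg ξ, Real.pi_gt_three]
    have h3 : (1 + ‖ξ‖) / 2 ≤ ‖bromwichLine ξ‖ := by rw [Real.norm_eq_abs]; linarith
    calc ‖bromwichLine ξ‖ ^ (-p) ≤ ((1 + ‖ξ‖) / 2) ^ (-p) :=
          Real.rpow_le_rpow_of_nonpos (by positivity) h3 (by linarith)
      _ = 2 ^ p * (1 + ‖ξ‖) ^ (-p) := by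
          rw [Real.div_rpow (by positivity) (by norm_num), Real.rpow_neg (by norm_num : (0:ℝ) ≤ 2)]
          field_simp

theorem norm_bromwichLine_cpow (p ξ : ℝ) :
    ‖bromwichLine ξ ^ (p : ℂ)‖ = ‖bromwichLine ξ‖ ^ p :=
  Complex.norm_cpow_real _ _

/-- Laplace's formula for the reciprocal Gamma function. -/
theorem integral_cexp_mul_bromwichLine_cpow {p : ℝ} (hp : 1 < p) :
    ∫ ξ : ℝ, cexp (bromwichLine ξ) * bromwichLine ξ ^ ((-p : ℝ) : ℂ)
      = ((Real.Gamma p)⁻¹ : ℝ) := by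
  have hp0 : 0 < p := by linarith
  have hG : Real.Gamma p ≠ 0 := (Real.Gamma_pos_of_pos hp0).ne'
  set f : ℝ → ℂ := (Set.Ioi (0 : ℝ)).indicator
    fun t => ((t ^ (p - 1) * Real.exp (-t) : ℝ) : ℂ) with hf
  have hfint : Integrable f := by
    rw [hf, integrable_indicator_iff measurableSet_Ioi]
    have h : IntegrableOn (fun t : ℝ => t ^ (p - 1) * Real.exp (-t)) (Set.Ioi 0) := by
      simpa [mul_comm] using Real.GammaIntegral_convergent hp0
    exact h.ofReal
  have hfour : FourierTransform.fourier f
      = fun ξ => (Real.Gamma p : ℂ) * bromwichLine ξ ^ ((-p : ℝ) : ℂ) := by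
    ext ξ
    rw [Real.fourier_real_eq_integral_exp_smul]
    have := integral_rpow_mul_cexp_neg_mul_Ioi hp0 (s := bromwichLine ξ)
      (by simp [bromwichLine_re])
    rw [Complex.ofReal_neg, ← this, ← integral_indicator measurableSet_Ioi]
    refine integral_congr_ae (Filter.Eventually.of_forall fun t => ?_)
    by_cases ht : t ∈ Set.Ioi (0 : ℝ)
    · simp only [hf, Set.indicator_of_mem ht, bromwichLine, smul_eq_mul]
      push_cast
      rw [mul_left_comm, ← Complex.exp_add]
      congr 2
      ring
    · simp [hf, Set.indicator_of_notMem ht]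
  have hFint : Integrable (FourierTransform.fourier f) := by
    rw [hfour]
    refine Integrable.const_mul ?_ _
    refine (integrable_norm_bromwichLine_rpow hp).mono'
      (continuous_bromwichLine_cpow _).aestronglyMeasurable ?_
    exact Filter.Eventually.of_forall fun ξ => (norm_bromwichLine_cpow _ _).le
  have hcont : ContinuousAt f 1 := by
    have h1 : ContinuousAt (fun t : ℝ => ((t ^ (p - 1) * Real.exp (-t) : ℝ) : ℂ)) 1 := by
      refine Complex.continuous_ofReal.continuousAt.comp ?_
      exact (Real.continuousAt_rpow_const _ _ (Or.inl one_ne_zero)).mul (by fun_prop)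
    refine h1.congr ?_
    filter_upwards [lt_mem_nhds (zero_lt_one (α := ℝ))] with t ht
    rw [hf, Set.indicator_of_mem (show t ∈ Set.Ioi (0 : ℝ) from ht)]
  have hinv := hfint.fourierInv_fourier_eq hFint hcont
  rw [Real.fourierInv_eq', hfour, hf, Set.indicator_of_mem (by simp)] at hinv
  have key : ∀ ξ : ℝ, cexp (bromwichLine ξ) * bromwichLine ξ ^ ((-p : ℝ) : ℂ)
      = ((Real.exp 1 * (Real.Gamma p)⁻¹ : ℝ) : ℂ) *
        (cexp (((2 * π * inner ℝ ξ 1 : ℝ) : ℂ) * I) •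
          ((Real.Gamma p : ℂ) * bromwichLine ξ ^ ((-p : ℝ) : ℂ))) := by
    intro ξ
    have : cexp (bromwichLine ξ) = Real.exp 1 * cexp (((2 * π * inner ℝ ξ 1 : ℝ) : ℂ) * I) := by
      simp [bromwichLine, Complex.exp_add]
    rw [this, smul_eq_mul]
    have hG' : (Real.Gamma p : ℂ) ≠ 0 := by exact_mod_cast hG
    push_cast
    field_simp
  simp_rw [key]
  rw [integral_const_mul, hinv, ← Complex.ofReal_mul]
  congr 1
  rw [Real.one_rpow, Real.exp_neg]
  field_simp

/-- A complex number whose argument stays away from `π` cannot be close to a negative real. -/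
theorem sqrt_mul_le_norm_one_add_mul {q x : ℝ} {w : ℂ} (hq0 : -1 ≤ q) (hq1 : q ≤ 1)
    (hx : 0 ≤ x) (hw : q * ‖w‖ ≤ w.re) :
    √((1 + q) / 2) * (1 + x * ‖w‖) ≤ ‖1 + (x : ℂ) * w‖ := by
  have h1 : ‖1 + (x : ℂ) * w‖ ^ 2 = 1 + 2 * (x * w.re) + (x * ‖w‖) ^ 2 := by
    rw [mul_pow, Complex.sq_norm, Complex.sq_norm, Complex.normSq_apply, Complex.normSq_apply]
    simp
    ring
  refine le_of_sq_le_sq ?_ (norm_nonneg _)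
  rw [mul_pow, Real.sq_sqrt (by linarith), h1]
  have h2 : x * (q * ‖w‖) ≤ x * w.re := mul_le_mul_of_nonneg_left hw hx
  nlinarith [mul_nonneg (sub_nonneg.2 hq1) (sq_nonneg (1 - x * ‖w‖))]

theorem cos_mul_norm_le_re_bromwichLine_cpow {α : ℝ} (hα0 : 0 ≤ α) (hα2 : α ≤ 2) (ξ : ℝ) :
    Real.cos (α * (π / 2)) * ‖bromwichLine ξ ^ ((-α : ℝ) : ℂ)‖
      ≤ (bromwichLine ξ ^ ((-α : ℝ) : ℂ)).re := by
  rw [Complex.cpow_ofReal_re, norm_bromwichLine_cpow, mul_comm]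
  refine mul_le_mul_of_nonneg_left ?_ (by positivity)
  have harg : |(bromwichLine ξ).arg| ≤ π / 2 :=
    Complex.abs_arg_le_pi_div_two_iff.2 (by simp [bromwichLine_re])
  rw [← Real.cos_abs ((bromwichLine ξ).arg * -α), abs_mul, abs_neg, abs_of_nonneg hα0]
  refine Real.cos_le_cos_of_nonneg_of_le_pi (by positivity) ?_ ?_
  · nlinarith [Real.pi_pos]
  · rw [mul_comm]
    exact mul_le_mul_of_nonneg_left harg hα0

theorem norm_bromwichLine_cpow_neg_le_one {p : ℝ} (hp : 0 ≤ p) (ξ : ℝ) :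
    ‖bromwichLine ξ ^ ((-p : ℝ) : ℂ)‖ ≤ 1 := by
  rw [norm_bromwichLine_cpow]
  exact Real.rpow_le_one_of_one_le_of_nonpos (one_le_norm_bromwichLine ξ) (by linarith)

/-- The integrand in the Laplace-type representation of `E_{α,β}(-z)`. -/
noncomputable def mittagLefflerKernel (α β : ℝ) (z : ℂ) (ξ : ℝ) : ℂ :=
  cexp (bromwichLine ξ) * bromwichLine ξ ^ ((-(β + 1) : ℝ) : ℂ) *
    (((β - α : ℝ) : ℂ) * (1 + z * bromwichLine ξ ^ ((-α : ℝ) : ℂ))⁻¹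
      + (α : ℂ) * ((1 + z * bromwichLine ξ ^ ((-α : ℝ) : ℂ))⁻¹) ^ 2)

theorem measurable_mittagLefflerKernel (α β : ℝ) (z : ℂ) :
    Measurable (mittagLefflerKernel α β z) := by
  have h1 := (continuous_bromwichLine_cpow ((-α : ℝ) : ℂ)).measurable
  have h2 := (continuous_bromwichLine_cpow ((-(β + 1) : ℝ) : ℂ)).measurable
  have h3 := continuous_bromwichLine.measurable
  unfold mittagLefflerKernel
  fun_prop

theorem norm_mittagLefflerKernel_le {α β : ℝ} {z : ℂ} {ξ : ℝ} {d : ℝ} (hd : 0 < d)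
    (hz : d ≤ ‖1 + z * bromwichLine ξ ^ ((-α : ℝ) : ℂ)‖) :
    ‖mittagLefflerKernel α β z ξ‖
      ≤ Real.exp 1 * ‖bromwichLine ξ‖ ^ (-(β + 1)) * (|β - α| * d⁻¹ + |α| * d⁻¹ ^ 2) := by
  have hinv : ‖(1 + z * bromwichLine ξ ^ ((-α : ℝ) : ℂ))⁻¹‖ ≤ d⁻¹ := by
    rw [norm_inv]; exact inv_anti₀ hd hz
  rw [mittagLefflerKernel, norm_mul, norm_mul, norm_cexp_bromwichLine, norm_bromwichLine_cpow]
  refine mul_le_mul_of_nonneg_left ((norm_add_le _ _).trans ?_) (by positivity)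
  rw [norm_mul, norm_mul, norm_pow, Complex.norm_real, Complex.norm_real, Real.norm_eq_abs,
    Real.norm_eq_abs]
  gcongr

theorem integrable_mittagLefflerKernel {α β : ℝ} {z : ℂ} {d : ℝ} (hβ : 0 < β) (hd : 0 < d)
    (hz : ∀ ξ, d ≤ ‖1 + z * bromwichLine ξ ^ ((-α : ℝ) : ℂ)‖) :
    Integrable (mittagLefflerKernel α β z) := by
  refine (((integrable_norm_bromwichLine_rpow (p := β + 1) (by linarith)).const_mul
    (Real.exp 1)).mul_const _).mono' (measurable_mittagLefflerKernel α β z).aestronglyMeasurable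
    (Filter.Eventually.of_forall fun ξ => norm_mittagLefflerKernel_le hd (hz ξ))

theorem differentiableOn_integral_mittagLefflerKernel {α β : ℝ} {d : ℝ} {U : Set ℂ} (hα : 0 ≤ α)
    (hβ : 0 < β) (hd : 0 < d) (hU : IsOpen U)
    (hz : ∀ z ∈ U, ∀ ξ, d ≤ ‖1 + z * bromwichLine ξ ^ ((-α : ℝ) : ℂ)‖) :
    DifferentiableOn ℂ (fun z => ∫ ξ, mittagLefflerKernel α β z ξ) U := by
  intro z₀ hz₀
  refine (hasDerivAt_integral_of_dominated_loc_of_deriv_le (s := U)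
    (F' := fun (z : ℂ) (ξ : ℝ) =>
      cexp (bromwichLine ξ) * bromwichLine ξ ^ ((-(β + 1) : ℝ) : ℂ) *
        (-bromwichLine ξ ^ ((-α : ℝ) : ℂ) *
          (((β - α : ℝ) : ℂ) * ((1 + z * bromwichLine ξ ^ ((-α : ℝ) : ℂ))⁻¹) ^ 2
            + 2 * (α : ℂ) * ((1 + z * bromwichLine ξ ^ ((-α : ℝ) : ℂ))⁻¹) ^ 3)))
    (bound := fun ξ => Real.exp 1 * ‖bromwichLine ξ‖ ^ (-(β + 1)) *
      (1 * (|β - α| * d⁻¹ ^ 2 + 2 * |α| * d⁻¹ ^ 3)))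
    (hU.mem_nhds hz₀) ?_ ?_ ?_ ?_ ?_ ?_).2.differentiableAt.differentiableWithinAt
  · exact Filter.Eventually.of_forall fun z =>
      (measurable_mittagLefflerKernel α β z).aestronglyMeasurable
  · exact integrable_mittagLefflerKernel hβ hd (hz z₀ hz₀)
  · apply Measurable.aestronglyMeasurable
    have h1 := (continuous_bromwichLine_cpow ((-α : ℝ) : ℂ)).measurable
    have h2 := (continuous_bromwichLine_cpow ((-(β + 1) : ℝ) : ℂ)).measurable
    have h3 := continuous_bromwichLine.measurable
    fun_prop
  · refine Filter.Eventually.of_forall fun ξ z hzU => ?_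
    have hinv : ‖(1 + z * bromwichLine ξ ^ ((-α : ℝ) : ℂ))⁻¹‖ ≤ d⁻¹ := by
      rw [norm_inv]; exact inv_anti₀ hd (hz z hzU ξ)
    rw [norm_mul, norm_mul, norm_cexp_bromwichLine, norm_bromwichLine_cpow]
    refine mul_le_mul_of_nonneg_left ?_ (by positivity)
    rw [norm_mul, norm_neg]
    refine mul_le_mul (norm_bromwichLine_cpow_neg_le_one hα ξ) ((norm_add_le _ _).trans ?_)
      (norm_nonneg _) zero_le_one
    rw [norm_mul, norm_mul, norm_mul, norm_pow, norm_pow, Complex.norm_real, Complex.norm_real,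
      Real.norm_eq_abs, Real.norm_eq_abs, Complex.norm_ofNat]
    gcongr
  · exact ((integrable_norm_bromwichLine_rpow (p := β + 1) (by linarith)).const_mul
      (Real.exp 1)).mul_const _
  · refine Filter.Eventually.of_forall fun ξ z hzU => ?_
    have hne : 1 + z * bromwichLine ξ ^ ((-α : ℝ) : ℂ) ≠ 0 :=
      norm_pos_iff.1 (hd.trans_le (hz z hzU ξ))
    have h1 : HasDerivAt (fun z : ℂ => 1 + z * bromwichLine ξ ^ ((-α : ℝ) : ℂ))
        (1 * bromwichLine ξ ^ ((-α : ℝ) : ℂ)) z :=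
      ((hasDerivAt_id z).mul_const _).const_add 1
    have h2 := h1.fun_inv hne
    refine (((h2.const_mul ((β - α : ℝ) : ℂ)).add ((h2.pow 2).const_mul (α : ℂ))).const_mul
      (cexp (bromwichLine ξ) * bromwichLine ξ ^ ((-(β + 1) : ℝ) : ℂ))).congr_deriv ?_
    simp only [Nat.cast_ofNat, div_eq_mul_inv, ← inv_pow]
    generalize (1 + z * bromwichLine ξ ^ ((-α : ℝ) : ℂ))⁻¹ = u
    ring

theorem rpow_mul_exp_neg_le_Gamma {p c : ℝ} (hp : 1 ≤ p) (hc : 0 ≤ c) :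
    c ^ (p - 1) * Real.exp (-c) ≤ Real.Gamma p := by
  have hint := Real.GammaIntegral_convergent (s := p) (by linarith)
  rw [Real.Gamma_eq_integral (by linarith), ← integral_exp_neg_Ioi c, ← integral_const_mul]
  calc ∫ x in Set.Ioi c, c ^ (p - 1) * Real.exp (-x)
      ≤ ∫ x in Set.Ioi c, Real.exp (-x) * x ^ (p - 1) := by
        refine setIntegral_mono_on ((integrableOn_exp_neg_Ioi c).const_mul _)
          (hint.mono_set (Set.Ioi_subset_Ioi hc)) measurableSet_Ioi fun x hx => ?_
        rw [mul_comm]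
        exact mul_le_mul_of_nonneg_left
          (Real.rpow_le_rpow hc (le_of_lt hx) (by linarith)) (Real.exp_nonneg _)
    _ ≤ ∫ x in Set.Ioi 0, Real.exp (-x) * x ^ (p - 1) := by
        refine setIntegral_mono_set hint ?_ (Set.Ioi_subset_Ioi hc).eventuallyLE
        exact (ae_restrict_mem measurableSet_Ioi).mono fun x hx =>
          mul_nonneg (Real.exp_nonneg _) (Real.rpow_nonneg (le_of_lt hx) _)

theorem differentiable_mittagLeffler {α β : ℝ} (hα : 0 < α) (hβ : 1 ≤ β) :
    Differentiable ℂ (mittagLeffler α β) := by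
  intro z₀
  set R : ℝ := ‖z₀‖ + 1 with hR
  have hR0 : 0 < R := by positivity
  set c : ℝ := (2 * R) ^ α⁻¹ with hc
  have hc0 : 0 < c := by positivity
  have hcα : c ^ α = 2 * R := Real.rpow_inv_rpow (by positivity) hα.ne'
  have hsum : Summable fun k : ℕ => Real.exp c * c ^ (1 - β) * (1 / 2 : ℝ) ^ k :=
    (summable_geometric_of_lt_one (by norm_num) (by norm_num)).mul_left _
  have hdiff : DifferentiableOn ℂ (mittagLeffler α β) (Metric.ball 0 R) := by
    refine Complex.differentiableOn_tsum_of_summable_norm hsum (fun k => ?_) Metric.isOpen_ball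
      fun k w hw => ?_
    · fun_prop
    · have hw' : ‖w‖ ≤ R := by simpa using (Metric.mem_ball.1 hw).le
      have hp : 1 ≤ α * k + β := by nlinarith [mul_nonneg hα.le (Nat.cast_nonneg (α := ℝ) k)]
      have hG := rpow_mul_exp_neg_le_Gamma hp hc0.le
      have hG0 : 0 < Real.Gamma (α * k + β) := Real.Gamma_pos_of_pos (by linarith)
      rw [Complex.Gamma_ofReal, norm_div, norm_pow, Complex.norm_real,
        Real.norm_of_nonneg hG0.le, div_le_iff₀ hG0]
      have hexp : c ^ (α * k + β - 1) = (2 * R) ^ k * c ^ (β - 1) := by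
        rw [add_sub_assoc, Real.rpow_add hc0, Real.rpow_mul hc0.le, hcα, Real.rpow_natCast]
      have hone : c ^ (1 - β) * c ^ (β - 1) = 1 := by
        rw [← Real.rpow_add hc0]; simp
      have hone' : Real.exp c * Real.exp (-c) = 1 := by rw [← Real.exp_add]; simp
      calc ‖w‖ ^ k ≤ R ^ k := by gcongr
        _ = Real.exp c * c ^ (1 - β) * (1 / 2) ^ k * (c ^ (α * k + β - 1) * Real.exp (-c)) := by
          rw [hexp, mul_pow]
          have h2 : (1 / 2 : ℝ) ^ k * 2 ^ k = 1 := by rw [← mul_pow]; norm_num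
          linear_combination (-(R ^ k)) * hone' * (c ^ (1 - β) * c ^ (β - 1)) * (1 / 2) ^ k * 2 ^ k
            - R ^ k * hone * ((1 / 2 : ℝ) ^ k * 2 ^ k) - R ^ k * h2
        _ ≤ _ := by gcongr
  exact hdiff.differentiableAt (Metric.isOpen_ball.mem_nhds (by simp [hR]))

theorem mittagLeffler_neg_eq_integral_of_norm_lt_one {α β : ℝ} (hα : 0 < α) (hβ : 0 < β) {z : ℂ}
    (hz : ‖z‖ < 1) : mittagLeffler α β (-z) = ∫ ξ, mittagLefflerKernel α β z ξ := by
  set F : ℕ → ℝ → ℂ := fun k ξ => ((-z) ^ k * ((α * k + β : ℝ) : ℂ)) *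
    (cexp (bromwichLine ξ) * bromwichLine ξ ^ ((-(α * k + β + 1) : ℝ) : ℂ)) with hF
  have hpos : ∀ k : ℕ, 0 < α * k + β := fun k => by positivity
  have hnorm : ∀ k ξ, ‖F k ξ‖
      ≤ ‖z‖ ^ k * (α * k + β) * (Real.exp 1 * ‖bromwichLine ξ‖ ^ (-(β + 1))) := by
    intro k ξ
    simp only [hF]
    rw [norm_mul, norm_mul, norm_mul, norm_pow, norm_neg, Complex.norm_real,
      Real.norm_of_nonneg (hpos k).le, norm_cexp_bromwichLine, norm_bromwichLine_cpow]
    have := hpos k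
    have h1 : -(α * k + β + 1) ≤ -(β + 1) := by
      nlinarith [mul_nonneg hα.le (Nat.cast_nonneg (α := ℝ) k)]
    have h2 := one_le_norm_bromwichLine ξ
    gcongr
  have hI := (integrable_norm_bromwichLine_rpow (p := β + 1) (by linarith)).const_mul (Real.exp 1)
  have hint : ∀ k, Integrable (F k) := fun k => by
    refine (hI.const_mul (‖z‖ ^ k * (α * k + β))).mono' ?_ (Filter.Eventually.of_forall (hnorm k))
    exact (continuous_const.mul ((Complex.continuous_exp.comp continuous_bromwichLine).mul
      (continuous_bromwichLine_cpow _))).aestronglyMeasurable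
  have hsumm : Summable fun k : ℕ => ‖z‖ ^ k * (α * k + β) := by
    have hz' : ‖(‖z‖ : ℝ)‖ < 1 := by simpa using hz
    have h1 := (summable_pow_mul_geometric_of_norm_lt_one 1 hz').mul_left α
    have h2 := (summable_geometric_of_norm_lt_one hz').mul_left β
    refine (h1.add h2).congr fun k => ?_
    ring
  have hsum : Summable fun k => ∫ ξ, ‖F k ξ‖ := by
    refine Summable.of_nonneg_of_le (fun k => integral_nonneg fun ξ => norm_nonneg _) (fun k => ?_)
      (hsumm.mul_right (∫ ξ, Real.exp 1 * ‖bromwichLine ξ‖ ^ (-(β + 1))))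
    rw [← integral_const_mul]
    exact integral_mono (hint k).norm (hI.const_mul _) (hnorm k)
  have key := (hasSum_integral_of_summable_integral_norm hint hsum).tsum_eq
  have hlhs : ∀ k : ℕ, ∫ ξ, F k ξ = (-z) ^ k / Complex.Gamma ((α * k + β : ℝ) : ℂ) := by
    intro k
    have hne : (((α * k + β : ℝ)) : ℂ) ≠ 0 := by exact_mod_cast (hpos k).ne'
    have hG : (Real.Gamma (α * k + β) : ℂ) ≠ 0 := by
      exact_mod_cast (Real.Gamma_pos_of_pos (hpos k)).ne'
    simp only [hF]
    rw [integral_const_mul, integral_cexp_mul_bromwichLine_cpow (by linarith [hpos k]),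
      Real.Gamma_add_one (hpos k).ne', Complex.Gamma_ofReal, Complex.ofReal_inv,
      Complex.ofReal_mul]
    field_simp
  have hrhs : ∀ ξ, ∑' k, F k ξ = mittagLefflerKernel α β z ξ := by
    intro ξ
    set w := bromwichLine ξ ^ ((-α : ℝ) : ℂ) with hw
    have hy : ‖-(z * w)‖ < 1 := by
      rw [norm_neg, norm_mul]
      have := norm_bromwichLine_cpow_neg_le_one hα.le ξ
      nlinarith [norm_nonneg z, norm_nonneg w]
    have hne : 1 + z * w ≠ 0 := by
      intro h
      have : -(z * w) = 1 := by linear_combination -h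
      simp [this] at hy
    have hs1 := (hasSum_coe_mul_geometric_of_norm_lt_one hy).mul_left (α : ℂ)
    have hs2 := (hasSum_geometric_of_norm_lt_one hy).mul_left (β : ℂ)
    have hs := (hs1.add hs2).mul_left
      (cexp (bromwichLine ξ) * bromwichLine ξ ^ ((-(β + 1) : ℝ) : ℂ))
    have hterm : ∀ k : ℕ, F k ξ = cexp (bromwichLine ξ) * bromwichLine ξ ^ ((-(β + 1) : ℝ) : ℂ) *
        ((α : ℂ) * ((k : ℂ) * (-(z * w)) ^ k) + (β : ℂ) * (-(z * w)) ^ k) := by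
      intro k
      have hpow : bromwichLine ξ ^ ((-(α * k + β + 1) : ℝ) : ℂ)
          = bromwichLine ξ ^ ((-(β + 1) : ℝ) : ℂ) * w ^ k := by
        rw [hw, ← Complex.cpow_mul_nat, ← Complex.cpow_add _ _ (bromwichLine_ne_zero ξ)]
        congr 1
        push_cast
        ring
      simp only [hF]
      rw [hpow, neg_pow (z * w), mul_pow, neg_pow z]
      push_cast
      ring
    simp_rw [hterm]
    rw [hs.tsum_eq, mittagLefflerKernel, ← hw, sub_neg_eq_add]
    congr 1
    push_cast
    field_simp
    ring
  simp_rw [hlhs, hrhs] at key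
  exact key

theorem cos_mul_pi_div_two_mem {α : ℝ} (hα0 : 0 ≤ α) (hα2 : α < 2) :
    -1 < Real.cos (α * (π / 2)) := by
  rw [← Real.cos_pi]
  exact Real.cos_lt_cos_of_nonneg_of_le_pi (by positivity) le_rfl (by nlinarith [Real.pi_pos])

theorem mittagLeffler_neg_eq_integral {α β x : ℝ} (hα0 : 0 < α) (hα2 : α < 2) (hβ : 1 ≤ β)
    (hx : 0 < x) :
    mittagLeffler α β (-(x : ℂ)) = ∫ ξ, mittagLefflerKernel α β x ξ := by
  have hq := cos_mul_pi_div_two_mem hα0.le hα2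
  set q := Real.cos (α * (π / 2)) with hqdef
  set c := √((1 + q) / 2) with hc
  have hc0 : 0 < c := Real.sqrt_pos.2 (by linarith)
  set U : Set ℂ := {z | z.im < c * z.re} ∩ {z | -z.im < c * z.re} with hU
  have hUo : IsOpen U := (isOpen_lt Complex.continuous_im (by fun_prop)).inter
    (isOpen_lt (by fun_prop) (by fun_prop))
  have hUc : Convex ℝ U := by
    intro z hz w hw s t hs ht hst
    simp only [hU, Set.mem_inter_iff, Set.mem_ofPred_eq, Complex.add_re, Complex.add_im,
      Complex.real_smul, Complex.re_ofReal_mul, Complex.im_ofReal_mul] at hz hw ⊢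
    have hs' : s = 1 - t := by linarith
    subst hs'
    rcases hs.eq_or_lt with h | h
    · have : t = 1 := by linarith
      subst this
      constructor <;> linarith [hw.1, hw.2]
    · constructor <;> nlinarith [hz.1, hz.2, hw.1, hw.2]
  have hlow : ∀ z ∈ U, ∀ ξ, c ≤ ‖1 + z * bromwichLine ξ ^ ((-α : ℝ) : ℂ)‖ := by
    intro z hz ξ
    obtain ⟨h1, h2⟩ := hz
    simp only [Set.mem_ofPred_eq] at h1 h2
    set w := bromwichLine ξ ^ ((-α : ℝ) : ℂ) with hw
    have hre : 0 < z.re := by nlinarith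
    have habs : |z.im| ≤ c * z.re := abs_le.2 ⟨by linarith, h1.le⟩
    have h3 := sqrt_mul_le_norm_one_add_mul hq.le (Real.cos_le_one _) hre.le
      (cos_mul_norm_le_re_bromwichLine_cpow hα0.le hα2.le ξ)
    have h4 : 1 + (z.re : ℂ) * w = (1 + z * w) - (z.im : ℂ) * I * w := by
      linear_combination w * Complex.re_add_im z
    rw [← hw, h4] at h3
    have h5 := h3.trans (norm_sub_le _ _)
    rw [norm_mul ((z.im : ℂ) * I), norm_mul, Complex.norm_I, Complex.norm_real,
      Real.norm_eq_abs, mul_one] at h5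
    have h6 := mul_le_mul_of_nonneg_right habs (norm_nonneg w)
    nlinarith
  have hdiffL : DifferentiableOn ℂ (fun z => mittagLeffler α β (-z)) U :=
    ((differentiable_mittagLeffler hα0 hβ).comp differentiable_neg).differentiableOn
  have hdiffR := differentiableOn_integral_mittagLefflerKernel (β := β) hα0.le
    (by linarith) hc0 hUo hlow
  have hmem : ∀ y : ℝ, 0 < y → (y : ℂ) ∈ U := fun y hy => by
    simp only [hU, Set.mem_inter_iff, Set.mem_ofPred_eq, Complex.ofReal_re, Complex.ofReal_im]
    constructor <;> simpa using mul_pos hc0 hy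
  refine (hdiffL.analyticOnNhd hUo).eqOn_of_preconnected_of_eventuallyEq
    (hdiffR.analyticOnNhd hUo) hUc.isPreconnected (hmem (1 / 2) (by norm_num)) ?_ (hmem x hx)
  have hball : Metric.ball (0 : ℂ) 1 ∈ nhds (((1 / 2 : ℝ)) : ℂ) :=
    Metric.isOpen_ball.mem_nhds (by simp; norm_num)
  filter_upwards [hball] with z hz
  exact mittagLeffler_neg_eq_integral_of_norm_lt_one hα0 (by linarith) (by simpa using hz)

/-- Algebraic decay of the Mittag–Leffler function on the negative real axis. -/
theorem exists_norm_mittagLeffler_neg_le {α β γ : ℝ} (hα0 : 0 < α) (hα2 : α < 2) (hβ : 1 ≤ β)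
    (hγ0 : 0 ≤ γ) (hγ1 : γ ≤ 1) (hγβ : α * γ < β) :
    ∃ C : ℝ, 0 ≤ C ∧ ∀ x : ℝ, 0 < x → ‖mittagLeffler α β (-(x : ℂ))‖ ≤ C * x ^ (-γ) := by
  have hq := cos_mul_pi_div_two_mem hα0.le hα2
  set q := Real.cos (α * (π / 2)) with hqdef
  set c := √((1 + q) / 2) with hc
  have hc0 : 0 < c := Real.sqrt_pos.2 (by linarith)
  set A := Real.exp 1 * (|β - α| * c⁻¹ + |α| * c⁻¹ ^ 2) with hA
  have hI := integrable_norm_bromwichLine_rpow (p := β + 1 - α * γ) (by linarith)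
  refine ⟨A * ∫ ξ, ‖bromwichLine ξ‖ ^ (-(β + 1 - α * γ)), ?_, fun x hx => ?_⟩
  · exact mul_nonneg (by positivity) (integral_nonneg fun ξ => by positivity)
  rw [mittagLeffler_neg_eq_integral hα0 hα2 hβ hx, mul_right_comm, ← integral_const_mul]
  refine norm_integral_le_of_norm_le (hI.const_mul _) (Filter.Eventually.of_forall fun ξ => ?_)
  set w := bromwichLine ξ ^ ((-α : ℝ) : ℂ) with hw
  have hs : 0 < ‖bromwichLine ξ‖ := zero_lt_one.trans_le (one_le_norm_bromwichLine ξ)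
  have hwn : ‖w‖ = ‖bromwichLine ξ‖ ^ (-α) := norm_bromwichLine_cpow _ _
  have hw0 : 0 < ‖w‖ := by rw [hwn]; positivity
  have hr : 0 < x * ‖w‖ := by positivity
  have hlow := sqrt_mul_le_norm_one_add_mul hq.le (Real.cos_le_one _) hx.le
    (cos_mul_norm_le_re_bromwichLine_cpow hα0.le hα2.le ξ)
  have hd : 0 < c * (1 + x * ‖w‖) := by positivity
  refine (norm_mittagLefflerKernel_le hd hlow).trans ?_
  have hpow : (x * ‖w‖) ^ γ ≤ 1 + x * ‖w‖ := by
    calc (x * ‖w‖) ^ γ ≤ (1 + x * ‖w‖) ^ γ := by gcongr; linarith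
      _ ≤ (1 + x * ‖w‖) ^ (1 : ℝ) := Real.rpow_le_rpow_of_exponent_le (by linarith) hγ1
      _ = _ := Real.rpow_one _
  have hinv1 : (1 + x * ‖w‖)⁻¹ ≤ x ^ (-γ) * ‖bromwichLine ξ‖ ^ (α * γ) := by
    calc (1 + x * ‖w‖)⁻¹ ≤ ((x * ‖w‖) ^ γ)⁻¹ := inv_anti₀ (by positivity) hpow
      _ = _ := by
        rw [Real.mul_rpow hx.le hw0.le, mul_inv, ← Real.rpow_neg hx.le, ← Real.rpow_neg hw0.le,
          hwn, ← Real.rpow_mul hs.le, neg_mul_neg]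
  have hinv2 : (1 + x * ‖w‖)⁻¹ ≤ 1 := inv_le_one_of_one_le₀ (by linarith)
  have hinv0 : 0 ≤ (1 + x * ‖w‖)⁻¹ := by positivity
  have hsq : (c * (1 + x * ‖w‖))⁻¹ ^ 2 ≤ c⁻¹ ^ 2 * (1 + x * ‖w‖)⁻¹ := by
    rw [mul_inv, mul_pow]
    gcongr
    nlinarith
  calc Real.exp 1 * ‖bromwichLine ξ‖ ^ (-(β + 1)) *
        (|β - α| * (c * (1 + x * ‖w‖))⁻¹ + |α| * (c * (1 + x * ‖w‖))⁻¹ ^ 2)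
      ≤ Real.exp 1 * ‖bromwichLine ξ‖ ^ (-(β + 1)) *
        (|β - α| * (c⁻¹ * (1 + x * ‖w‖)⁻¹) + |α| * (c⁻¹ ^ 2 * (1 + x * ‖w‖)⁻¹)) := by
        rw [mul_inv c] at hsq ⊢
        gcongr
    _ = A * ‖bromwichLine ξ‖ ^ (-(β + 1)) * (1 + x * ‖w‖)⁻¹ := by rw [hA]; ring
    _ ≤ A * ‖bromwichLine ξ‖ ^ (-(β + 1)) * (x ^ (-γ) * ‖bromwichLine ξ‖ ^ (α * γ)) := by
        gcongr
    _ = A * x ^ (-γ) * ‖bromwichLine ξ‖ ^ (-(β + 1 - α * γ)) := by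
        have : -(β + 1 - α * γ) = -(β + 1) + α * γ := by ring
        rw [this, Real.rpow_add hs]
        ring

/-- Spectral-coefficient form of the estimate
`‖∇u‖_{L²(0,T;D(A^θ))} ≤ C(‖u₀‖_{H¹₀(Ω)} + ‖u₁‖_{L²(Ω)})` for `θ ∈ (0, 1/(2α))`. -/
theorem gradient_L2_Dtheta_estimate (α T θ : ℝ) (hα1 : 1 < α) (hα2 : α < 2)
    (hT : 0 < T) (hθ1 : 0 < θ) (hθ2 : θ < 1 / (2 * α))
    (lam a b : ℕ → ℝ) (hlam : ∀ n, 0 < lam n)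
    (ha : Summable (fun n => lam n * (a n) ^ 2))
    (hb : Summable (fun n => (b n) ^ 2)) :
    ∃ C : ℝ, 0 < C ∧
      ∫⁻ t in Set.Ioo (0 : ℝ) T, ∑' n : ℕ, ENNReal.ofReal ((lam n) ^ (1 + 2 * θ) *
          ‖((a n : ℝ) : ℂ) * mittagLeffler α 1 ((-(lam n * t ^ α) : ℝ) : ℂ)
            + ((b n * t : ℝ) : ℂ) * mittagLeffler α 2 ((-(lam n * t ^ α) : ℝ) : ℂ)‖ ^ 2)
        ≤ ENNReal.ofReal (C * ((∑' n : ℕ, lam n * (a n) ^ 2) + ∑' n : ℕ, (b n) ^ 2)) := by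
  have hα0 : 0 < α := by linarith
  have hαθ : α * θ < 1 / 2 := by
    rw [lt_div_iff₀ (by positivity)] at hθ2
    linarith
  have hθ3 : θ < 1 / 2 := by nlinarith
  obtain ⟨C₁, hC₁, hE₁⟩ := exists_norm_mittagLeffler_neg_le (β := 1) (γ := θ) hα0 hα2 le_rfl
    hθ1.le (by linarith) (by linarith)
  obtain ⟨C₂, hC₂, hE₂⟩ := exists_norm_mittagLeffler_neg_le (β := 2) (γ := 1 / 2 + θ) hα0 hα2
    one_le_two (by linarith) (by linarith) (by nlinarith)
  set G : ℝ → ℝ := fun t =>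
    2 * C₁ ^ 2 * t ^ (-(2 * α * θ)) + 2 * C₂ ^ 2 * t ^ (2 - α - 2 * α * θ) with hG
  have hG0 : ∀ t ∈ Set.Ioo 0 T, 0 ≤ G t := fun t ht => by
    have := ht.1
    simp only [hG]
    positivity
  have hGint : IntegrableOn G (Set.Ioo 0 T) := by
    have h : ∀ r : ℝ, -1 < r → IntegrableOn (fun t : ℝ => t ^ r) (Set.Ioo 0 T) := fun r hr =>
      ((intervalIntegrable_iff_integrableOn_Ioo_of_le hT.le).1
        (intervalIntegral.intervalIntegrable_rpow' hr))
    exact ((h _ (by linarith)).const_mul _).add ((h _ (by linarith)).const_mul _)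
  have hterm : ∀ t ∈ Set.Ioo 0 T, ∀ n, (lam n) ^ (1 + 2 * θ) *
      ‖((a n : ℝ) : ℂ) * mittagLeffler α 1 ((-(lam n * t ^ α) : ℝ) : ℂ)
        + ((b n * t : ℝ) : ℂ) * mittagLeffler α 2 ((-(lam n * t ^ α) : ℝ) : ℂ)‖ ^ 2
      ≤ G t * (lam n * (a n) ^ 2 + (b n) ^ 2) := by
    intro t ht n
    have ht0 : 0 < t := ht.1
    have hl := hlam n
    have hx : 0 < lam n * t ^ α := by positivity
    have h1 := hE₁ _ hx
    have h2 := hE₂ _ hx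
    rw [← Complex.ofReal_neg] at h1 h2
    set e₁ := mittagLeffler α 1 ((-(lam n * t ^ α) : ℝ) : ℂ)
    set e₂ := mittagLeffler α 2 ((-(lam n * t ^ α) : ℝ) : ℂ)
    have hsq₁ : ‖e₁‖ ^ 2 ≤ (C₁ * (lam n * t ^ α) ^ (-θ)) ^ 2 := by gcongr
    have hsq₂ : ‖e₂‖ ^ 2 ≤ (C₂ * (lam n * t ^ α) ^ (-(1 / 2 + θ))) ^ 2 := by gcongr
    have hpow : ∀ γ : ℝ, ((lam n * t ^ α) ^ (-γ)) ^ 2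
        = (lam n) ^ (-(2 * γ)) * t ^ (-(2 * α * γ)) := by
      intro γ
      rw [← Real.rpow_natCast, ← Real.rpow_mul hx.le, Real.mul_rpow hl.le (by positivity),
        ← Real.rpow_mul ht0.le]
      push_cast
      ring_nf
    rw [mul_pow, hpow] at hsq₁ hsq₂
    have hl₁ : (lam n) ^ (1 + 2 * θ) * (lam n) ^ (-(2 * θ)) = lam n := by
      rw [← Real.rpow_add hl]; simp
    have hl₂ : (lam n) ^ (1 + 2 * θ) * (lam n) ^ (-(2 * (1 / 2 + θ))) = 1 := by
      rw [← Real.rpow_add hl]; ring_nf; simp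
    have ht₂ : t ^ 2 * t ^ (-(2 * α * (1 / 2 + θ))) = t ^ (2 - α - 2 * α * θ) := by
      rw [← Real.rpow_natCast, ← Real.rpow_add ht0]; push_cast; ring_nf
    have hnorm : ‖((a n : ℝ) : ℂ) * e₁ + ((b n * t : ℝ) : ℂ) * e₂‖ ^ 2
        ≤ 2 * ((a n) ^ 2 * ‖e₁‖ ^ 2) + 2 * ((b n) ^ 2 * t ^ 2 * ‖e₂‖ ^ 2) := by
      have h := norm_add_le (((a n : ℝ) : ℂ) * e₁) (((b n * t : ℝ) : ℂ) * e₂)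
      rw [norm_mul, norm_mul, Complex.norm_real, Complex.norm_real, Real.norm_eq_abs,
        Real.norm_eq_abs] at h
      calc _ ≤ (|a n| * ‖e₁‖ + |b n * t| * ‖e₂‖) ^ 2 := by gcongr
        _ ≤ 2 * ((|a n| * ‖e₁‖) ^ 2 + (|b n * t| * ‖e₂‖) ^ 2) := add_sq_le
        _ = _ := by rw [mul_pow, mul_pow, sq_abs, sq_abs]; ring
    have hnn₁ : 0 ≤ 2 * C₁ ^ 2 * t ^ (-(2 * α * θ)) * (b n) ^ 2 := by positivity
    have hnn₂ : 0 ≤ 2 * C₂ ^ 2 * t ^ (2 - α - 2 * α * θ) * (lam n * (a n) ^ 2) := by positivity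
    calc _ ≤ (lam n) ^ (1 + 2 * θ) * (2 * ((a n) ^ 2 * ‖e₁‖ ^ 2)
          + 2 * ((b n) ^ 2 * t ^ 2 * ‖e₂‖ ^ 2)) := by gcongr
      _ ≤ (lam n) ^ (1 + 2 * θ) *
          (2 * ((a n) ^ 2 * (C₁ ^ 2 * ((lam n) ^ (-(2 * θ)) * t ^ (-(2 * α * θ)))))
          + 2 * ((b n) ^ 2 * t ^ 2 * (C₂ ^ 2 * ((lam n) ^ (-(2 * (1 / 2 + θ)))
            * t ^ (-(2 * α * (1 / 2 + θ))))))) := by gcongr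
      _ = 2 * C₁ ^ 2 * t ^ (-(2 * α * θ)) * (lam n * (a n) ^ 2)
          + 2 * C₂ ^ 2 * t ^ (2 - α - 2 * α * θ) * (b n) ^ 2 := by
        rw [← ht₂]
        linear_combination 2 * C₁ ^ 2 * t ^ (-(2 * α * θ)) * (a n) ^ 2 * hl₁
          + 2 * C₂ ^ 2 * (t ^ 2 * t ^ (-(2 * α * (1 / 2 + θ)))) * (b n) ^ 2 * hl₂
      _ ≤ _ := by simp only [hG]; linarith
  set S := (∑' n : ℕ, lam n * (a n) ^ 2) + ∑' n : ℕ, (b n) ^ 2 with hS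
  have hnn : ∀ n, 0 ≤ lam n * (a n) ^ 2 + (b n) ^ 2 := fun n => by
    have := hlam n
    positivity
  have hS' : ∑' n, (lam n * (a n) ^ 2 + (b n) ^ 2) = S := ha.tsum_add hb
  have hS0 : 0 ≤ S := hS' ▸ tsum_nonneg hnn
  have hD : 0 ≤ ∫ t in Set.Ioo 0 T, G t := setIntegral_nonneg measurableSet_Ioo hG0
  refine ⟨(∫ t in Set.Ioo 0 T, G t) + 1, by linarith, ?_⟩
  calc _ ≤ ∫⁻ t in Set.Ioo (0 : ℝ) T, ENNReal.ofReal (G t * S) := by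
        refine setLIntegral_mono_ae' measurableSet_Ioo
          (Filter.Eventually.of_forall fun t ht => ?_)
        calc _ ≤ ∑' n, ENNReal.ofReal (G t * (lam n * (a n) ^ 2 + (b n) ^ 2)) :=
              ENNReal.tsum_le_tsum fun n => ENNReal.ofReal_le_ofReal (hterm t ht n)
          _ = ENNReal.ofReal (G t * S) := by
              rw [← hS', ← tsum_mul_left, ENNReal.ofReal_tsum_of_nonneg
                (fun n => mul_nonneg (hG0 t ht) (hnn n)) ((ha.add hb).mul_left _)]
    _ = ENNReal.ofReal ((∫ t in Set.Ioo 0 T, G t) * S) := by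
        rw [← integral_mul_const, ofReal_integral_eq_lintegral_ofReal (hGint.mul_const S)]
        exact (ae_restrict_mem measurableSet_Ioo).mono fun t ht => mul_nonneg (hG0 t ht) hS0
    _ ≤ _ := ENNReal.ofReal_le_ofReal (by nlinarith)
end

section
/- Let 1 < α < 2, T > 0 and ε ∈ ((2−α)/(2α), 1/2). Let (λ_n) be a sequence of positive reals, and let (a_n), (b_n) be real sequences with Σ_n λ_n^{1+2ε} a_n² < ∞ and Σ_n b_n² < ∞. Then: (i) lim_{t→0⁺} Σ_{n=1}^∞ | −λ_n a_n t^{α−1} E_{α,α}(−λ_n t^α) + b_n (E_{α,1}(−λ_n t^α) − 1) |² = 0; and (ii) there exists C > 0 such that for every t ∈ [0,T], Σ_{n=1}^∞ | −λ_n a_n t^{α−1} E_{α,α}(−λ_n t^α) + b_n E_{α,1}(−λ_n t^α) |² ≤ C ( Σ_n λ_n^{1+2ε} a_n² + Σ_n b_n² ). (This is the spectral-coefficient form of the statement that if u₀ ∈ D(A^{1/2+ε}) and u₁ ∈ L²(Ω) then ∂_t u ∈ C([0,T];L²(Ω)) with ∂_t u(t,·) → u₁ in L²(Ω) as t → 0.)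 -/
open Complex Real Filter Topology

section

open MeasureTheory

/-- The real Mittag–Leffler series. -/
noncomputable def realMittagLeffler (α β x : ℝ) : ℝ :=
  ∑' k : ℕ, x ^ k / Real.Gamma (α * k + β)

lemma mittagLeffler_ofReal (α β x : ℝ) :
    mittagLeffler α β (x : ℂ) = (realMittagLeffler α β x : ℂ) := by
  unfold mittagLeffler realMittagLeffler
  rw [Complex.ofReal_tsum]
  refine tsum_congr fun k => ?_
  rw [Complex.Gamma_ofReal]
  push_cast
  rfl

lemma inv_Gamma_le_inv_factorial {α β : ℝ} (hα : 1 ≤ α) (hβ : 1 ≤ β) (k : ℕ) (hk : k ≠ 0) :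
    (Real.Gamma (α * k + β))⁻¹ ≤ ((k.factorial : ℝ))⁻¹ := by
  have hk1 : (1 : ℝ) ≤ k := by exact_mod_cast Nat.one_le_iff_ne_zero.mpr hk
  have h1 : (k : ℝ) + 1 ≤ α * k + β := by nlinarith
  rw [← Real.Gamma_nat_eq_factorial]
  refine inv_anti₀ (Real.Gamma_pos_of_pos (by linarith)) ?_
  exact Real.Gamma_strictMonoOn_Ici.monotoneOn (by simp only [Set.mem_Ici]; linarith)
    (by simp only [Set.mem_Ici]; linarith) h1

lemma summable_pow_div_Gamma {α β : ℝ} (hα : 1 ≤ α) (hβ : 1 ≤ β) (R : ℝ) (hR : 0 ≤ R) :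
    Summable fun k : ℕ => R ^ k / Real.Gamma (α * k + β) := by
  refine Summable.of_norm_bounded_eventually_nat (Real.summable_pow_div_factorial R) ?_
  filter_upwards [eventually_ne_atTop 0] with k hk
  have hΓ : 0 < Real.Gamma (α * k + β) := Real.Gamma_pos_of_pos (by positivity)
  rw [Real.norm_of_nonneg (by positivity), div_eq_mul_inv, div_eq_mul_inv]
  exact mul_le_mul_of_nonneg_left (inv_Gamma_le_inv_factorial hα hβ k hk) (by positivity)

lemma summable_realMittagLeffler {α β : ℝ} (hα : 1 ≤ α) (hβ : 1 ≤ β) (x : ℝ) :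
    Summable fun k : ℕ => x ^ k / Real.Gamma (α * k + β) := by
  refine Summable.of_norm ?_
  convert! summable_pow_div_Gamma hα hβ |x| (abs_nonneg x) using 2 with k
  have hΓ : 0 < Real.Gamma (α * k + β) := Real.Gamma_pos_of_pos (by positivity)
  rw [norm_div, norm_pow, Real.norm_eq_abs, Real.norm_of_nonneg hΓ.le]

lemma continuous_realMittagLeffler {α β : ℝ} (hα : 1 ≤ α) (hβ : 1 ≤ β) :
    Continuous (realMittagLeffler α β) := by
  rw [continuous_iff_continuousAt]
  intro x
  have h : ContinuousOn (realMittagLeffler α β) (Set.Icc (-(|x| + 1)) (|x| + 1)) := by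
    refine continuousOn_tsum (fun k => by fun_prop)
      (summable_pow_div_Gamma hα hβ (|x| + 1) (by positivity)) ?_
    intro k y hy
    have hΓ : 0 < Real.Gamma (α * k + β) := Real.Gamma_pos_of_pos (by positivity)
    rw [norm_div, norm_pow, Real.norm_eq_abs, Real.norm_of_nonneg hΓ.le]
    have : |y| ≤ |x| + 1 := abs_le.mpr hy
    gcongr
  refine h.continuousAt (Icc_mem_nhds ?_ ?_)
  · linarith [neg_abs_le x]
  · linarith [le_abs_self x]

lemma realMittagLeffler_one {α : ℝ} (hα : 1 ≤ α) (x : ℝ) :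
    realMittagLeffler α 1 x = 1 + x * realMittagLeffler α (α + 1) x := by
  unfold realMittagLeffler
  rw [(summable_realMittagLeffler hα le_rfl x).tsum_eq_zero_add, ← tsum_mul_left]
  congr 1
  · simp
  · refine tsum_congr fun k => ?_
    rw [pow_succ, show α * ((k + 1 : ℕ) : ℝ) + 1 = α * k + (α + 1) by push_cast; ring]
    ring

lemma intervalIntegrable_sub_rpow {σ : ℝ} (hσ : 0 < σ) (t a b : ℝ) :
    IntervalIntegrable (fun s : ℝ => (t - s) ^ (σ - 1)) volume a b := by
  have := (intervalIntegral.intervalIntegrable_rpow' (a := t - a) (b := t - b)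
    (r := σ - 1) (by linarith)).comp_sub_left t
  simpa using this

lemma intervalIntegrable_sub_rpow_mul {σ : ℝ} (hσ : 0 < σ) {f : ℝ → ℝ} (hf : Continuous f)
    (t a b : ℝ) :
    IntervalIntegrable (fun s : ℝ => (t - s) ^ (σ - 1) * f s) volume a b :=
  (intervalIntegrable_sub_rpow hσ t a b).mul_continuousOn hf.continuousOn

lemma integral_sub_rpow {σ : ℝ} (hσ : 0 < σ) (t a : ℝ) :
    ∫ s in (0 : ℝ)..a, (t - s) ^ (σ - 1) = (t ^ σ - (t - a) ^ σ) / σ := by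
  rw [intervalIntegral.integral_comp_sub_left (fun s => s ^ (σ - 1)) t,
    integral_rpow (Or.inl (by linarith))]
  simp

lemma integral_sub_rpow_mul_rpow {σ p t : ℝ} (hσ : 0 < σ) (hp : 0 < p) (ht : 0 < t) :
    ∫ s in (0 : ℝ)..t, (t - s) ^ (σ - 1) * s ^ (p - 1) =
      t ^ (p + σ - 1) * (Real.Gamma p * Real.Gamma σ / Real.Gamma (p + σ)) := by
  have h := Complex.betaIntegral_scaled (p : ℂ) (σ : ℂ) ht
  rw [Complex.betaIntegral_eq_Gamma_mul_div _ _ (by simpa) (by simpa), ← Complex.ofReal_add,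
    Complex.Gamma_ofReal, Complex.Gamma_ofReal, Complex.Gamma_ofReal] at h
  have h2 : ∫ x in (0 : ℝ)..t, (x : ℂ) ^ ((p : ℂ) - 1) * ((t : ℂ) - x) ^ ((σ : ℂ) - 1) =
      ∫ x in (0 : ℝ)..t, (((t - x) ^ (σ - 1) * x ^ (p - 1) : ℝ) : ℂ) := by
    refine intervalIntegral.integral_congr fun x hx => ?_
    rw [Set.uIcc_of_le ht.le] at hx
    rw [Complex.ofReal_mul, Complex.ofReal_cpow hx.1, Complex.ofReal_cpow (by linarith [hx.2])]
    push_cast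
    ring
  rw [h2, intervalIntegral.integral_ofReal] at h
  have h3 : (t : ℂ) ^ (((p + σ : ℝ) : ℂ) - 1) = ((t ^ (p + σ - 1) : ℝ) : ℂ) := by
    rw [Complex.ofReal_cpow ht.le]
    push_cast
    rfl
  rw [h3] at h
  exact_mod_cast h

/-- Fractional integration of order `σ` raises the second Mittag–Leffler parameter by `σ`. -/
lemma integral_sub_rpow_mul_mittagLeffler {α β σ t : ℝ} (hα : 1 ≤ α) (hβ : 1 ≤ β) (hσ : 0 < σ)
    (ht : 0 < t) :
    ∫ s in (0 : ℝ)..t, (t - s) ^ (σ - 1) * (s ^ (β - 1) * realMittagLeffler α β (-s ^ α)) =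
      Real.Gamma σ * (t ^ (β + σ - 1) * realMittagLeffler α (β + σ) (-t ^ α)) := by
  set F : ℕ → ℝ → ℝ := fun k s =>
    (t - s) ^ (σ - 1) * s ^ (α * k + β - 1) * ((-1) ^ k / Real.Gamma (α * k + β)) with hF
  have hpos : ∀ k : ℕ, 0 < α * k + β := fun k => by positivity
  have hone : ∀ k : ℕ, 0 ≤ α * k + β - 1 := fun k => by
    have : 0 ≤ α * k := by positivity
    linarith
  have hint : ∀ k : ℕ, IntegrableOn (fun s => (t - s) ^ (σ - 1) * s ^ (α * k + β - 1))
      (Set.Ioc 0 t) := fun k => by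
    rw [← intervalIntegrable_iff_integrableOn_Ioc_of_le ht.le]
    exact intervalIntegrable_sub_rpow_mul hσ (Real.continuous_rpow_const (hone k)) t 0 t
  have hFint : ∀ k, Integrable (F k) (volume.restrict (Set.Ioc 0 t)) := fun k =>
    (hint k).mul_const _
  have hpow : ∀ s : ℝ, 0 < s → ∀ (k : ℕ) (γ : ℝ),
      s ^ (α * k + γ - 1) = s ^ (γ - 1) * (s ^ α) ^ k := fun s hs k γ => by
    rw [← Real.rpow_natCast, ← Real.rpow_mul hs.le, ← Real.rpow_add hs]
    congr 1
    ring
  have hval : ∀ k : ℕ, ∫ s in Set.Ioc 0 t, (t - s) ^ (σ - 1) * s ^ (α * k + β - 1) =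
      t ^ (α * k + (β + σ) - 1) *
        (Real.Gamma (α * k + β) * Real.Gamma σ / Real.Gamma (α * k + (β + σ))) := fun k => by
    rw [← intervalIntegral.integral_of_le ht.le, integral_sub_rpow_mul_rpow hσ (hpos k) ht,
      add_assoc (α * k)]
  have hG : ∀ k : ℕ, 0 < Real.Gamma (α * k + β) := fun k => Real.Gamma_pos_of_pos (hpos k)
  have hsum : Summable fun k => ∫ s in Set.Ioc 0 t, ‖F k s‖ := by
    have : ∀ k, ∫ s in Set.Ioc 0 t, ‖F k s‖ = Real.Gamma σ * t ^ (β + σ - 1) *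
        ((t ^ α) ^ k / Real.Gamma (α * k + (β + σ))) := fun k => by
      rw [setIntegral_congr_fun (g := fun s => (t - s) ^ (σ - 1) * s ^ (α * k + β - 1) *
        (Real.Gamma (α * k + β))⁻¹) measurableSet_Ioc, integral_mul_const, hval, hpow t ht]
      · have := (hG k).ne'
        field_simp
      · intro s hs
        simp only [hF]
        rw [norm_mul, norm_div, norm_pow, norm_neg, norm_one, one_pow,
          Real.norm_of_nonneg (hG k).le, Real.norm_of_nonneg, one_div]
        exact mul_nonneg (Real.rpow_nonneg (by linarith [hs.2]) _)
          (Real.rpow_nonneg hs.1.le _)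
    simp_rw [this]
    exact (summable_pow_div_Gamma hα (by linarith) _ (by positivity)).mul_left _
  have key := (hasSum_integral_of_summable_integral_norm hFint hsum).tsum_eq
  rw [intervalIntegral.integral_of_le ht.le]
  have e1 : ∫ s in Set.Ioc 0 t, ∑' k, F k s = ∫ s in Set.Ioc 0 t,
      (t - s) ^ (σ - 1) * (s ^ (β - 1) * realMittagLeffler α β (-s ^ α)) := by
    refine setIntegral_congr_fun measurableSet_Ioc fun s hs => ?_
    simp only [hF, realMittagLeffler]
    rw [← tsum_mul_left, ← tsum_mul_left]
    refine tsum_congr fun k => ?_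
    rw [hpow s hs.1, neg_pow (s ^ α)]
    ring
  rw [← e1, ← key]
  unfold realMittagLeffler
  rw [← tsum_mul_left, ← tsum_mul_left]
  refine tsum_congr fun k => ?_
  simp only [hF]
  rw [integral_mul_const, hval, hpow t ht, neg_pow (t ^ α)]
  have := (hG k).ne'
  field_simp

/-- The convolution of `f` with the exponential kernel `u ↦ exp (-r u)` on `[0, t]`. -/
noncomputable def expConv (f : ℝ → ℝ) (t r : ℝ) : ℝ :=
  ∫ s in (0 : ℝ)..t, Real.exp (-(r * (t - s))) * f s

lemma expConv_eq (f : ℝ → ℝ) (t r : ℝ) :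
    expConv f t r = Real.exp (-(r * t)) * ∫ s in (0 : ℝ)..t, Real.exp (r * s) * f s := by
  rw [expConv, ← intervalIntegral.integral_const_mul]
  refine intervalIntegral.integral_congr fun s _ => ?_
  rw [← mul_assoc, ← Real.exp_add]
  congr 2
  ring

lemma hasDerivAt_expConv {f : ℝ → ℝ} (hf : Continuous f) (t r : ℝ) :
    HasDerivAt (fun t => expConv f t r) (f t - r * expConv f t r) t := by
  have hc : Continuous fun s => Real.exp (r * s) * f s := by fun_prop
  have h1 : HasDerivAt (fun t => ∫ s in (0 : ℝ)..t, Real.exp (r * s) * f s)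
      (Real.exp (r * t) * f t) t := hc.integral_hasStrictDerivAt 0 t |>.hasDerivAt
  have h2 : HasDerivAt (fun t => Real.exp (-(r * t))) (Real.exp (-(r * t)) * -(r * 1)) t :=
    (((hasDerivAt_id t).const_mul r).neg).exp
  have h3 := h2.mul h1
  have e : (fun t => expConv f t r) = fun t =>
      Real.exp (-(r * t)) * ∫ s in (0 : ℝ)..t, Real.exp (r * s) * f s :=
    funext fun t => expConv_eq f t r
  rw [e]
  refine h3.congr_deriv ?_
  have : Real.exp (-(r * t)) * (Real.exp (r * t) * f t) = f t := by
    rw [← mul_assoc, ← Real.exp_add]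
    simp
  rw [this, expConv_eq]
  ring

lemma continuous_uncurry_expConv {f : ℝ → ℝ} (hf : Continuous f) :
    Continuous fun p : ℝ × ℝ => expConv f p.1 p.2 := by
  have h : Continuous fun p : ℝ × ℝ => ∫ s in (0 : ℝ)..p.1, Real.exp (p.2 * s) * f s :=
    intervalIntegral.continuous_parametric_intervalIntegral_of_continuous
      (f := fun (p : ℝ × ℝ) s => Real.exp (p.2 * s) * f s) (by fun_prop) continuous_fst
  simp_rw [expConv_eq]
  fun_prop

lemma integral_mul_expConv_nonneg {f : ℝ → ℝ} (hf : Continuous f) {T r : ℝ} (hT : 0 ≤ T)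
    (hr : 0 ≤ r) : 0 ≤ ∫ t in (0 : ℝ)..T, f t * expConv f t r := by
  have hw : Continuous fun t => expConv f t r :=
    continuous_iff_continuousAt.mpr fun t => (hasDerivAt_expConv hf t r).continuousAt
  have h1 : ∫ t in (0 : ℝ)..T, 2 * expConv f t r * (f t - r * expConv f t r) =
      expConv f T r ^ 2 - expConv f 0 r ^ 2 := by
    refine intervalIntegral.integral_eq_sub_of_hasDerivAt (f := fun t => expConv f t r ^ 2)
      (fun t _ => ?_) (Continuous.intervalIntegrable (by fun_prop) _ _)
    simpa using (hasDerivAt_expConv hf t r).fun_pow 2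
  have h0 : expConv f 0 r = 0 := by simp [expConv]
  have h2 : ∫ t in (0 : ℝ)..T, f t * expConv f t r =
      (∫ t in (0 : ℝ)..T, 2 * expConv f t r * (f t - r * expConv f t r)) / 2 +
        r * ∫ t in (0 : ℝ)..T, expConv f t r ^ 2 := by
    rw [← intervalIntegral.integral_div, ← intervalIntegral.integral_const_mul,
      ← intervalIntegral.integral_add (Continuous.intervalIntegrable (by fun_prop) _ _)
        (Continuous.intervalIntegrable (by fun_prop) _ _)]
    refine intervalIntegral.integral_congr fun t _ => ?_
    ring
  rw [h2, h1, h0, zero_pow two_ne_zero, sub_zero]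
  have : 0 ≤ ∫ t in (0 : ℝ)..T, expConv f t r ^ 2 :=
    intervalIntegral.integral_nonneg hT fun _ _ => sq_nonneg _
  positivity

lemma integral_rpow_neg_mul_exp {β u : ℝ} (hβ : β < 1) (hu : 0 < u) :
    ∫ r in Set.Ioi (0 : ℝ), r ^ (-β) * Real.exp (-(r * u)) =
      Real.Gamma (1 - β) * u ^ (β - 1) := by
  have h := Real.integral_rpow_mul_exp_neg_mul_Ioi (a := 1 - β) (r := u) (by linarith) hu
  rw [show 1 - β - 1 = -β by ring] at h
  simp_rw [mul_comm _ u]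
  rw [h, one_div, Real.inv_rpow hu.le, ← Real.rpow_neg hu.le, mul_comm]
  ring_nf

lemma integrableOn_rpow_neg_mul_exp {β u : ℝ} (hβ : β < 1) (hu : 0 < u) :
    IntegrableOn (fun r : ℝ => r ^ (-β) * Real.exp (-(r * u))) (Set.Ioi 0) := by
  have h := integrableOn_rpow_mul_exp_neg_mul_rpow (p := 1) (s := -β) (b := u) (by linarith)
    one_pos hu
  simpa [mul_comm] using h

lemma integrable_rpow_neg_mul_exp_prod {β : ℝ} (hβ0 : 0 < β) (hβ : β < 1) {f : ℝ → ℝ}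
    (hf : Continuous f) (t : ℝ) :
    Integrable (fun p : ℝ × ℝ => p.2 ^ (-β) * (Real.exp (-(p.2 * (t - p.1))) * f p.1))
      ((volume.restrict (Set.Ioo 0 t)).prod (volume.restrict (Set.Ioi 0))) := by
  have hm : Measurable fun p : ℝ × ℝ =>
      p.2 ^ (-β) * (Real.exp (-(p.2 * (t - p.1))) * f p.1) := by
    have := hf.measurable
    fun_prop
  rw [integrable_prod_iff hm.aestronglyMeasurable]
  constructor
  · filter_upwards [ae_restrict_mem measurableSet_Ioo] with s hs
    have := (integrableOn_rpow_neg_mul_exp hβ (sub_pos.mpr hs.2)).mul_const (f s)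
    simpa only [mul_assoc] using this
  · have h1 : IntegrableOn (fun s => Real.Gamma (1 - β) * ((t - s) ^ (β - 1) * |f s|))
        (Set.Ioo 0 t) := by
      rcases le_or_gt t 0 with ht | ht
      · simp [Set.Ioo_eq_empty_of_le ht]
      · refine Integrable.const_mul ?_ _
        have := intervalIntegrable_sub_rpow_mul hβ0 hf.abs t 0 t
        rw [intervalIntegrable_iff_integrableOn_Ioc_of_le ht.le] at this
        exact this.mono_set Set.Ioo_subset_Ioc_self
    refine h1.congr_fun (fun s hs => ?_) measurableSet_Ioo
    simp only
    rw [← mul_assoc, ← integral_rpow_neg_mul_exp hβ (sub_pos.mpr hs.2), ← integral_mul_const]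
    refine setIntegral_congr_fun measurableSet_Ioi fun r hr => ?_
    simp only [norm_mul, Real.norm_eq_abs, Real.abs_exp]
    rw [abs_of_nonneg (Real.rpow_nonneg (le_of_lt hr) _), mul_assoc]

lemma expConv_eq_setIntegral (f : ℝ → ℝ) {t : ℝ} (ht : 0 ≤ t) (r : ℝ) :
    expConv f t r = ∫ s in Set.Ioo 0 t, Real.exp (-(r * (t - s))) * f s := by
  rw [expConv, intervalIntegral.integral_of_le ht, integral_Ioc_eq_integral_Ioo]

lemma Gamma_mul_integral_sub_rpow_mul {β : ℝ} (hβ0 : 0 < β) (hβ : β < 1) {f : ℝ → ℝ}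
    (hf : Continuous f) {t : ℝ} (ht : 0 ≤ t) :
    Real.Gamma (1 - β) * ∫ s in (0 : ℝ)..t, (t - s) ^ (β - 1) * f s =
      ∫ r in Set.Ioi (0 : ℝ), r ^ (-β) * expConv f t r := by
  have h := integral_integral_swap (f := fun s r : ℝ =>
    r ^ (-β) * (Real.exp (-(r * (t - s))) * f s)) (integrable_rpow_neg_mul_exp_prod hβ0 hβ hf t)
  simp_rw [expConv_eq_setIntegral f ht, ← integral_const_mul]
  rw [← h, ← intervalIntegral.integral_const_mul, intervalIntegral.integral_of_le ht,
    integral_Ioc_eq_integral_Ioo]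
  refine setIntegral_congr_fun measurableSet_Ioo fun s hs => ?_
  simp only [← mul_assoc]
  rw [integral_mul_const, integral_rpow_neg_mul_exp hβ (sub_pos.mpr hs.2)]

lemma abs_expConv_le {f : ℝ → ℝ} {M t T : ℝ} (ht : 0 ≤ t) (htT : t ≤ T)
    (hM : ∀ s ∈ Set.Icc 0 T, |f s| ≤ M) (r : ℝ) :
    |expConv f t r| ≤ M * expConv (fun _ => 1) T r := by
  have hM0 : 0 ≤ M := (abs_nonneg _).trans (hM 0 ⟨le_rfl, ht.trans htT⟩)
  have hsub : ∀ x, expConv (fun _ => 1) x r = ∫ u in (0 : ℝ)..x, Real.exp (-(r * u)) := fun x => by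
    simp only [expConv, mul_one]
    rw [intervalIntegral.integral_comp_sub_left (fun u => Real.exp (-(r * u))) x]
    simp
  have hi : ∀ x y, IntervalIntegrable (fun u => Real.exp (-(r * u))) volume x y :=
    fun x y => Continuous.intervalIntegrable (by fun_prop) _ _
  have h1 : |expConv f t r| ≤ M * expConv (fun _ => 1) t r := by
    unfold expConv
    rw [← intervalIntegral.integral_const_mul, ← Real.norm_eq_abs]
    refine intervalIntegral.norm_integral_le_of_norm_le ht ?_
      (Continuous.intervalIntegrable (by fun_prop) _ _)
    refine Eventually.of_forall fun s hs => ?_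
    rw [norm_mul, Real.norm_eq_abs, Real.norm_eq_abs, Real.abs_exp, mul_one, mul_comm]
    have := hM s ⟨hs.1.le, hs.2.trans htT⟩
    gcongr
  refine h1.trans (mul_le_mul_of_nonneg_left ?_ hM0)
  rw [hsub, hsub, ← intervalIntegral.integral_add_adjacent_intervals (hi 0 t) (hi t T)]
  have : 0 ≤ ∫ u in t..T, Real.exp (-(r * u)) :=
    intervalIntegral.integral_nonneg htT fun _ _ => (Real.exp_pos _).le
  linarith

/-- The kernel `u ↦ u ^ (β - 1)` of fractional integration is of positive type. -/
lemma integral_mul_integral_sub_rpow_mul_nonneg {β : ℝ} (hβ0 : 0 < β) (hβ : β < 1) {f : ℝ → ℝ}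
    (hf : Continuous f) {T : ℝ} (hT : 0 ≤ T) :
    0 ≤ ∫ t in (0 : ℝ)..T, f t * ∫ s in (0 : ℝ)..t, (t - s) ^ (β - 1) * f s := by
  have hΓ : 0 < Real.Gamma (1 - β) := Real.Gamma_pos_of_pos (by linarith)
  obtain ⟨M, hM⟩ := isCompact_Icc.exists_bound_of_continuousOn (s := Set.Icc 0 T) hf.continuousOn
  simp only [Real.norm_eq_abs] at hM
  have hM0 : 0 ≤ M := (abs_nonneg _).trans (hM 0 ⟨le_rfl, hT⟩)
  have hint : Integrable (fun p : ℝ × ℝ => p.2 ^ (-β) * (f p.1 * expConv f p.1 p.2))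
      ((volume.restrict (Set.Ioc 0 T)).prod (volume.restrict (Set.Ioi 0))) := by
    have hg : Integrable (fun r : ℝ => r ^ (-β) * expConv (fun _ => 1) T r)
        (volume.restrict (Set.Ioi 0)) := by
      have := (integrable_rpow_neg_mul_exp_prod hβ0 hβ
        (continuous_const (y := (1 : ℝ))) T).integral_prod_right
      simpa only [integral_const_mul, ← expConv_eq_setIntegral _ hT] using this
    have hdom := (integrable_const (μ := volume.restrict (Set.Ioc 0 T)) (M * M)).mul_prod hg
    have hm : Measurable fun p : ℝ × ℝ => p.2 ^ (-β) * (f p.1 * expConv f p.1 p.2) := by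
      have h1 := hf.measurable
      have h2 := (continuous_uncurry_expConv hf).measurable
      fun_prop
    refine hdom.mono' hm.aestronglyMeasurable ?_
    rw [Measure.prod_restrict]
    filter_upwards [ae_restrict_mem (measurableSet_Ioc.prod measurableSet_Ioi)] with p hp
    have hp1 := hp.1
    have hp2 : 0 < p.2 := hp.2
    rw [norm_mul, norm_mul, Real.norm_eq_abs, Real.norm_eq_abs, Real.norm_eq_abs,
      abs_of_nonneg (Real.rpow_nonneg hp2.le _)]
    have b1 := hM p.1 ⟨hp1.1.le, hp1.2⟩
    have b2 := abs_expConv_le hp1.1.le hp1.2 hM p.2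
    calc p.2 ^ (-β) * (|f p.1| * |expConv f p.1 p.2|)
        ≤ p.2 ^ (-β) * (M * (M * expConv (fun _ => 1) T p.2)) := by gcongr
      _ = _ := by ring
  have hswap := integral_integral_swap (f := fun t r : ℝ => r ^ (-β) * (f t * expConv f t r)) hint
  have hleft : ∫ t in Set.Ioc 0 T, ∫ r in Set.Ioi (0 : ℝ), r ^ (-β) * (f t * expConv f t r) =
      Real.Gamma (1 - β) *
        ∫ t in (0 : ℝ)..T, f t * ∫ s in (0 : ℝ)..t, (t - s) ^ (β - 1) * f s := by
    rw [← intervalIntegral.integral_const_mul, intervalIntegral.integral_of_le hT]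
    refine setIntegral_congr_fun measurableSet_Ioc fun t ht => ?_
    rw [mul_left_comm, Gamma_mul_integral_sub_rpow_mul hβ0 hβ hf ht.1.le, ← integral_const_mul]
    refine setIntegral_congr_fun measurableSet_Ioi fun r _ => ?_
    ring
  have hright : 0 ≤ ∫ r in Set.Ioi (0 : ℝ), ∫ t in Set.Ioc 0 T,
      r ^ (-β) * (f t * expConv f t r) := by
    refine setIntegral_nonneg measurableSet_Ioi fun r hr => ?_
    have hr0 : 0 < r := hr
    rw [integral_const_mul, ← intervalIntegral.integral_of_le hT]
    exact mul_nonneg (Real.rpow_nonneg hr0.le _) (integral_mul_expConv_nonneg hf hT hr0.le)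
  rw [← hswap, hleft] at hright
  exact (mul_nonneg_iff_of_pos_left hΓ).mp hright

/-- The solution `t ↦ t ^ (α - 1) E_{α,α}(-t ^ α)`, extended evenly to the real line, of the
fractional oscillation equation with impulse data. -/
noncomputable def mlImpulse (α t : ℝ) : ℝ :=
  |t| ^ (α - 1) * realMittagLeffler α α (-|t| ^ α)

/-- The primitive of `-mlImpulse α` with value `1` at `0`; it equals `E_{α,1}(-t ^ α)` for
`0 ≤ t`. -/
noncomputable def mlOscillation (α t : ℝ) : ℝ :=
  1 - ∫ s in (0 : ℝ)..t, mlImpulse α s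

lemma continuous_mlImpulse {α : ℝ} (hα : 1 ≤ α) : Continuous (mlImpulse α) := by
  have h := continuous_realMittagLeffler hα hα
  have h1 : Continuous fun t : ℝ => |t| ^ (α - 1) :=
    (Real.continuous_rpow_const (by linarith)).comp continuous_abs
  have h2 : Continuous fun t : ℝ => |t| ^ α :=
    (Real.continuous_rpow_const (by linarith)).comp continuous_abs
  exact h1.mul (h.comp h2.neg)

lemma hasDerivAt_mlOscillation {α : ℝ} (hα : 1 ≤ α) (t : ℝ) :
    HasDerivAt (mlOscillation α) (-mlImpulse α t) t := by
  have h := ((continuous_mlImpulse hα).integral_hasStrictDerivAt 0 t).hasDerivAt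
  exact h.const_sub 1

lemma continuous_mlOscillation {α : ℝ} (hα : 1 ≤ α) : Continuous (mlOscillation α) :=
  continuous_iff_continuousAt.mpr fun t => (hasDerivAt_mlOscillation hα t).continuousAt

lemma mlOscillation_eq {α t : ℝ} (hα : 1 ≤ α) (ht : 0 ≤ t) :
    mlOscillation α t = realMittagLeffler α 1 (-t ^ α) := by
  rcases ht.eq_or_lt with rfl | ht
  · rw [realMittagLeffler_one hα, Real.zero_rpow (by linarith)]
    simp [mlOscillation]
  · have h := integral_sub_rpow_mul_mittagLeffler hα hα one_pos ht
    rw [realMittagLeffler_one hα, mlOscillation]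
    have e : ∫ s in (0 : ℝ)..t, mlImpulse α s = ∫ s in (0 : ℝ)..t,
        (t - s) ^ ((1 : ℝ) - 1) * (s ^ (α - 1) * realMittagLeffler α α (-s ^ α)) := by
      refine intervalIntegral.integral_congr fun s hs => ?_
      rw [Set.uIcc_of_le ht.le] at hs
      simp only [mlImpulse, sub_self, Real.rpow_zero, one_mul, abs_of_nonneg hs.1]
    rw [e, h, Real.Gamma_one, add_sub_cancel_right]
    ring

lemma mlImpulse_eq_integral {α t : ℝ} (hα : 1 < α) (ht : 0 ≤ t) :
    Real.Gamma (α - 1) * mlImpulse α t =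
      ∫ s in (0 : ℝ)..t, (t - s) ^ (α - 1 - 1) * mlOscillation α s := by
  rcases ht.eq_or_lt with rfl | ht
  · simp [mlImpulse, Real.zero_rpow (sub_pos.mpr hα).ne']
  · have h := integral_sub_rpow_mul_mittagLeffler hα.le le_rfl (sub_pos.mpr hα) ht
    have e : ∫ s in (0 : ℝ)..t, (t - s) ^ (α - 1 - 1) * mlOscillation α s =
        ∫ s in (0 : ℝ)..t, (t - s) ^ (α - 1 - 1) *
          (s ^ ((1 : ℝ) - 1) * realMittagLeffler α 1 (-s ^ α)) := by
      refine intervalIntegral.integral_congr fun s hs => ?_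
      rw [Set.uIcc_of_le ht.le] at hs
      simp only [sub_self, Real.rpow_zero, one_mul, mlOscillation_eq hα.le hs.1]
    rw [e, h, mlImpulse, abs_of_pos ht, add_sub_cancel]

/-- Energy estimate: `(f²)' = -2 f (k * f)` for `f = E_{α,1}(-t ^ α)` and a kernel `k` of positive
type. -/
lemma abs_mlOscillation_le_one {α T : ℝ} (hα1 : 1 < α) (hα2 : α < 2) (hT : 0 ≤ T) :
    |mlOscillation α T| ≤ 1 := by
  have hf := continuous_mlOscillation hα1.le
  have hV := continuous_mlImpulse hα1.le
  have hΓ : 0 < Real.Gamma (α - 1) := Real.Gamma_pos_of_pos (by linarith)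
  have h1 : ∫ t in (0 : ℝ)..T, 2 * mlOscillation α t * (-mlImpulse α t) =
      mlOscillation α T ^ 2 - mlOscillation α 0 ^ 2 := by
    refine intervalIntegral.integral_eq_sub_of_hasDerivAt (f := fun t => mlOscillation α t ^ 2)
      (fun t _ => ?_) (Continuous.intervalIntegrable (by fun_prop) _ _)
    simpa using (hasDerivAt_mlOscillation hα1.le t).fun_pow 2
  have h0 : mlOscillation α 0 = 1 := by simp [mlOscillation]
  have h2 := integral_mul_integral_sub_rpow_mul_nonneg (β := α - 1) (by linarith) (by linarith)
    hf hT
  have h3 : ∫ t in (0 : ℝ)..T, mlOscillation α t *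
      ∫ s in (0 : ℝ)..t, (t - s) ^ (α - 1 - 1) * mlOscillation α s =
      -(Real.Gamma (α - 1) / 2) * ∫ t in (0 : ℝ)..T, 2 * mlOscillation α t * (-mlImpulse α t) := by
    rw [← intervalIntegral.integral_const_mul]
    refine intervalIntegral.integral_congr fun t ht => ?_
    rw [Set.uIcc_of_le hT] at ht
    rw [← mlImpulse_eq_integral hα1 ht.1]
    ring
  rw [h3, h1, h0] at h2
  rw [← sq_le_one_iff_abs_le_one]
  nlinarith

lemma abs_mlImpulse_le_rpow {α t : ℝ} (hα1 : 1 < α) (hα2 : α < 2) (ht : 0 ≤ t) :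
    |mlImpulse α t| ≤ t ^ (α - 1) / Real.Gamma α := by
  have hβ : 0 < α - 1 := by linarith
  have hΓ : 0 < Real.Gamma (α - 1) := Real.Gamma_pos_of_pos hβ
  have hΓα : Real.Gamma α = (α - 1) * Real.Gamma (α - 1) := by
    rw [← Real.Gamma_add_one hβ.ne', sub_add_cancel]
  have h : ‖∫ s in (0 : ℝ)..t, (t - s) ^ (α - 1 - 1) * mlOscillation α s‖ ≤
      ∫ s in (0 : ℝ)..t, (t - s) ^ (α - 1 - 1) := by
    refine intervalIntegral.norm_integral_le_of_norm_le ht ?_ (intervalIntegrable_sub_rpow hβ _ _ _)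
    refine Eventually.of_forall fun s hs => ?_
    have h0 : 0 ≤ (t - s) ^ (α - 1 - 1) := Real.rpow_nonneg (by linarith [hs.2]) _
    rw [norm_mul, Real.norm_of_nonneg h0]
    exact mul_le_of_le_one_right h0 (abs_mlOscillation_le_one hα1 hα2 hs.1.le)
  rw [← mlImpulse_eq_integral hα1 ht, integral_sub_rpow hβ, sub_self, Real.zero_rpow hβ.ne',
    sub_zero, norm_mul, Real.norm_of_nonneg hΓ.le, Real.norm_eq_abs] at h
  rw [hΓα, le_div_iff₀ (by positivity)]
  rw [le_div_iff₀ hβ] at h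
  linarith

lemma abs_mlImpulse_sub_le {α S T : ℝ} (hα1 : 1 < α) (hα2 : α < 2) (hS : 0 ≤ S) (hST : S < T) :
    |mlImpulse α T - mlImpulse α S| ≤ 2 * (T - S) ^ (α - 1) / Real.Gamma α := by
  have hβ : 0 < α - 1 := by linarith
  have hΓ : 0 < Real.Gamma (α - 1) := Real.Gamma_pos_of_pos hβ
  have hΓα : Real.Gamma α = (α - 1) * Real.Gamma (α - 1) := by
    rw [← Real.Gamma_add_one hβ.ne', sub_add_cancel]
  have hf := continuous_mlOscillation hα1.le
  have hi : ∀ t a b, IntervalIntegrable (fun s => (t - s) ^ (α - 1 - 1) * mlOscillation α s)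
      volume a b := intervalIntegrable_sub_rpow_mul hβ hf
  have hi0 : ∀ t a b, IntervalIntegrable (fun s : ℝ => (t - s) ^ (α - 1 - 1)) volume a b :=
    intervalIntegrable_sub_rpow hβ
  have hsplit : Real.Gamma (α - 1) * (mlImpulse α T - mlImpulse α S) =
      (∫ s in S..T, (T - s) ^ (α - 1 - 1) * mlOscillation α s) -
      ∫ s in (0 : ℝ)..S, ((S - s) ^ (α - 1 - 1) - (T - s) ^ (α - 1 - 1)) * mlOscillation α s := by
    simp_rw [sub_mul]
    rw [mul_sub, mlImpulse_eq_integral hα1 hS, mlImpulse_eq_integral hα1 (hS.trans hST.le),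
      intervalIntegral.integral_sub (hi S 0 S) (hi T 0 S),
      ← intervalIntegral.integral_add_adjacent_intervals (hi T 0 S) (hi T S T)]
    ring
  have h1 : ‖∫ s in S..T, (T - s) ^ (α - 1 - 1) * mlOscillation α s‖ ≤
      ∫ s in S..T, (T - s) ^ (α - 1 - 1) := by
    refine intervalIntegral.norm_integral_le_of_norm_le hST.le ?_ (hi0 _ _ _)
    refine Eventually.of_forall fun s hs => ?_
    have h0 : 0 ≤ (T - s) ^ (α - 1 - 1) := Real.rpow_nonneg (by linarith [hs.2]) _
    rw [norm_mul, Real.norm_of_nonneg h0]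
    exact mul_le_of_le_one_right h0 (abs_mlOscillation_le_one hα1 hα2 (hS.trans hs.1.le))
  have h2 : ‖∫ s in (0 : ℝ)..S,
      ((S - s) ^ (α - 1 - 1) - (T - s) ^ (α - 1 - 1)) * mlOscillation α s‖ ≤
      ∫ s in (0 : ℝ)..S, ((S - s) ^ (α - 1 - 1) - (T - s) ^ (α - 1 - 1)) := by
    rw [intervalIntegral.integral_of_le hS, intervalIntegral.integral_of_le hS,
      integral_Ioc_eq_integral_Ioo, integral_Ioc_eq_integral_Ioo]
    refine norm_integral_le_of_norm_le ?_ ?_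
    · have := (hi0 S 0 S).sub (hi0 T 0 S)
      rw [intervalIntegrable_iff_integrableOn_Ioc_of_le hS] at this
      exact this.mono_set Set.Ioo_subset_Ioc_self
    · filter_upwards [ae_restrict_mem measurableSet_Ioo] with s hs
      have h0 : 0 ≤ (S - s) ^ (α - 1 - 1) - (T - s) ^ (α - 1 - 1) := by
        rw [sub_nonneg]
        exact Real.rpow_le_rpow_of_nonpos (by linarith [hs.2]) (by linarith) (by linarith)
      rw [norm_mul, Real.norm_of_nonneg h0]
      exact mul_le_of_le_one_right h0 (abs_mlOscillation_le_one hα1 hα2 hs.1.le)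
  have v1 : ∫ s in S..T, (T - s) ^ (α - 1 - 1) = (T - S) ^ (α - 1) / (α - 1) := by
    rw [intervalIntegral.integral_comp_sub_left (fun s => s ^ (α - 1 - 1)) T,
      integral_rpow (Or.inl (by linarith))]
    simp [hβ.ne']
  have v2 : ∫ s in (0 : ℝ)..S, ((S - s) ^ (α - 1 - 1) - (T - s) ^ (α - 1 - 1)) ≤
      (T - S) ^ (α - 1) / (α - 1) := by
    rw [intervalIntegral.integral_sub (hi0 S 0 S) (hi0 T 0 S), integral_sub_rpow hβ,
      integral_sub_rpow hβ, sub_self, Real.zero_rpow hβ.ne', ← sub_div]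
    have := Real.rpow_le_rpow hS hST.le hβ.le
    gcongr
    linarith
  have h3 : Real.Gamma (α - 1) * |mlImpulse α T - mlImpulse α S| ≤
      2 * ((T - S) ^ (α - 1) / (α - 1)) := by
    nth_rw 1 [← abs_of_pos hΓ]
    rw [← abs_mul, hsplit]
    refine (abs_sub _ _).trans ?_
    rw [Real.norm_eq_abs] at h1 h2
    linarith
  rw [hΓα, le_div_iff₀ (by positivity)]
  have h4 := mul_le_mul_of_nonneg_right h3 hβ.le
  rw [mul_assoc 2, div_mul_cancel₀ _ hβ.ne'] at h4
  linarith

lemma abs_mlImpulse_le {α t : ℝ} (hα1 : 1 < α) (hα2 : α < 2) (ht : 0 ≤ t) :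
    |mlImpulse α t| ≤ 2 + 2 / Real.Gamma α := by
  have hΓ : 0 < Real.Gamma α := Real.Gamma_pos_of_pos (by linarith)
  obtain ⟨ξ, hξ, hξ'⟩ := exists_hasDerivAt_eq_slope (mlOscillation α) (fun s => -mlImpulse α s)
    (lt_add_one t) (continuous_mlOscillation hα1.le).continuousOn
    (fun s _ => hasDerivAt_mlOscillation hα1.le s)
  have h1 := abs_mlOscillation_le_one hα1 hα2 ht
  have h2 := abs_mlOscillation_le_one hα1 hα2 (by linarith : 0 ≤ t + 1)
  have h3 : |mlImpulse α ξ| ≤ 2 := by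
    rw [← abs_neg, hξ', add_sub_cancel_left, div_one]
    exact (abs_sub _ _).trans (by linarith)
  have h4 := abs_mlImpulse_sub_le hα1 hα2 ht hξ.1
  have h5 : (ξ - t) ^ (α - 1) ≤ 1 :=
    Real.rpow_le_one (by linarith [hξ.1]) (by linarith [hξ.2]) (by linarith)
  have h6 : 2 * (ξ - t) ^ (α - 1) / Real.Gamma α ≤ 2 / Real.Gamma α := by
    gcongr
    linarith
  have h7 := abs_sub_abs_le_abs_sub (mlImpulse α t) (mlImpulse α ξ)
  rw [abs_sub_comm] at h7
  linarith

lemma exists_abs_mlImpulse_le_rpow {α : ℝ} (hα1 : 1 < α) (hα2 : α < 2) :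
    ∃ M : ℝ, 0 < M ∧ ∀ δ t : ℝ, 0 ≤ δ → δ ≤ α - 1 → 0 ≤ t → |mlImpulse α t| ≤ M * t ^ δ := by
  have hΓ : 0 < Real.Gamma α := Real.Gamma_pos_of_pos (by linarith)
  refine ⟨2 + 2 / Real.Gamma α, by positivity, fun δ t hδ0 hδ ht => ?_⟩
  rcases le_total t 1 with h | h
  · rcases ht.eq_or_lt with rfl | ht0
    · rw [mlImpulse, abs_zero, Real.zero_rpow (by linarith), zero_mul, abs_zero]
      positivity
    · have h1 := abs_mlImpulse_le_rpow hα1 hα2 ht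
      have h2 : t ^ (α - 1) ≤ t ^ δ := Real.rpow_le_rpow_of_exponent_ge ht0 h hδ
      calc |mlImpulse α t| ≤ t ^ (α - 1) / Real.Gamma α := h1
        _ ≤ t ^ δ / Real.Gamma α := by gcongr
        _ = 1 / Real.Gamma α * t ^ δ := by ring
        _ ≤ (2 + 2 / Real.Gamma α) * t ^ δ := by
          gcongr
          have : 1 / Real.Gamma α ≤ 2 / Real.Gamma α := by gcongr; norm_num
          linarith
  · refine (abs_mlImpulse_le hα1 hα2 ht).trans (le_mul_of_one_le_right (by positivity) ?_)
    exact Real.one_le_rpow h hδ0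

lemma rpow_inv_mul_rpow {α l t : ℝ} (hα : 0 < α) (hl : 0 < l) (ht : 0 ≤ t) :
    (l ^ α⁻¹ * t) ^ α = l * t ^ α := by
  rw [Real.mul_rpow (by positivity) ht, ← Real.rpow_mul hl.le, inv_mul_cancel₀ hα.ne',
    Real.rpow_one]

lemma mittagLeffler_one_eq_mlOscillation {α l t : ℝ} (hα : 1 ≤ α) (hl : 0 < l) (ht : 0 ≤ t) :
    mittagLeffler α 1 ((-(l * t ^ α) : ℝ) : ℂ) = (mlOscillation α (l ^ α⁻¹ * t) : ℂ) := by
  rw [mittagLeffler_ofReal, mlOscillation_eq hα (by positivity),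
    rpow_inv_mul_rpow (by linarith) hl ht]

lemma mul_rpow_mul_mittagLeffler {α l t : ℝ} (hα : 1 ≤ α) (hl : 0 < l) (ht : 0 ≤ t) :
    l * t ^ (α - 1) * realMittagLeffler α α (-(l * t ^ α)) =
      l ^ α⁻¹ * mlImpulse α (l ^ α⁻¹ * t) := by
  have hα0 : 0 < α := by linarith
  rw [mlImpulse, abs_of_nonneg (by positivity), rpow_inv_mul_rpow hα0 hl ht,
    Real.mul_rpow (by positivity) ht, ← Real.rpow_mul hl.le, ← mul_assoc, ← mul_assoc,
    ← Real.rpow_add hl]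
  congr 2
  rw [show α⁻¹ + α⁻¹ * (α - 1) = 1 by field_simp; ring, Real.rpow_one]

lemma exists_norm_position_term_sq_le {α ε : ℝ} (hα1 : 1 < α) (hα2 : α < 2)
    (hε1 : (2 - α) / (2 * α) < ε) (hε2 : ε < 1 / 2) :
    ∃ M δ : ℝ, 0 < M ∧ 0 < δ ∧ ∀ l a t : ℝ, 0 < l → 0 ≤ t →
      ‖((-(l * a * t ^ (α - 1)) : ℝ) : ℂ) * mittagLeffler α α ((-(l * t ^ α) : ℝ) : ℂ)‖ ^ 2 ≤
        M * t ^ δ * (l ^ (1 + 2 * ε) * a ^ 2) := by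
  have hα0 : 0 < α := by linarith
  obtain ⟨M, hM, hbound⟩ := exists_abs_mlImpulse_le_rpow hα1 hα2
  rw [div_lt_iff₀ (by positivity)] at hε1
  set δ := α / 2 + α * ε - 1 with hδ
  have hδ0 : 0 < δ := by rw [hδ]; linarith
  have hδ1 : δ ≤ α - 1 := by rw [hδ]; nlinarith
  refine ⟨M ^ 2, 2 * δ, by positivity, by positivity, fun l a t hl ht => ?_⟩
  have hb := hbound δ (l ^ α⁻¹ * t) hδ0.le hδ1 (by positivity)
  have hexp : l ^ α⁻¹ * (l ^ α⁻¹ * t) ^ δ = l ^ (1 / 2 + ε) * t ^ δ := by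
    rw [Real.mul_rpow (by positivity) ht, ← Real.rpow_mul hl.le, ← mul_assoc, ← Real.rpow_add hl]
    congr 2
    rw [hδ]
    field_simp
    ring
  have hle : ‖((-(l * a * t ^ (α - 1)) : ℝ) : ℂ) *
      mittagLeffler α α ((-(l * t ^ α) : ℝ) : ℂ)‖ ≤ M * (l ^ (1 / 2 + ε) * t ^ δ) * |a| := by
    rw [mittagLeffler_ofReal, ← Complex.ofReal_mul, Complex.norm_real, Real.norm_eq_abs,
      show -(l * a * t ^ (α - 1)) * realMittagLeffler α α (-(l * t ^ α)) =
        -(l * t ^ (α - 1) * realMittagLeffler α α (-(l * t ^ α)) * a) by ring,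
      mul_rpow_mul_mittagLeffler hα1.le hl ht, abs_neg, abs_mul, abs_mul,
      abs_of_nonneg (Real.rpow_nonneg hl.le _), ← hexp]
    calc l ^ α⁻¹ * |mlImpulse α (l ^ α⁻¹ * t)| * |a|
        ≤ l ^ α⁻¹ * (M * (l ^ α⁻¹ * t) ^ δ) * |a| := by gcongr
      _ = _ := by ring
  calc _ ≤ (M * (l ^ (1 / 2 + ε) * t ^ δ) * |a|) ^ 2 := by gcongr
    _ = M ^ 2 * (t ^ δ) ^ 2 * ((l ^ (1 / 2 + ε)) ^ 2 * |a| ^ 2) := by ring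
    _ = _ := by
      rw [sq_abs, ← Real.rpow_natCast (t ^ δ), ← Real.rpow_natCast (l ^ (1 / 2 + ε)),
        ← Real.rpow_mul ht, ← Real.rpow_mul hl.le]
      push_cast
      ring_nf

lemma norm_add_sq_le_two_mul (z w : ℂ) : ‖z + w‖ ^ 2 ≤ 2 * ‖z‖ ^ 2 + 2 * ‖w‖ ^ 2 := by
  have h : ‖z + w‖ ^ 2 ≤ (‖z‖ + ‖w‖) ^ 2 := by gcongr; exact norm_add_le z w
  nlinarith [sq_nonneg (‖z‖ - ‖w‖)]

end

/-- Spectral-coefficient form of: for `u₀ ∈ D(A^{1/2+ε})`, `ε ∈ ((2-α)/(2α), 1/2)`,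
and `u₁ ∈ L²(Ω)`, one has `∂_t u ∈ C([0,T];L²(Ω))` with `∂_t u(t,·) → u₁` in `L²(Ω)`. -/
theorem velocity_L2_continuity (α T ε : ℝ) (hα1 : 1 < α) (hα2 : α < 2)
    (hT : 0 < T) (hε1 : (2 - α) / (2 * α) < ε) (hε2 : ε < 1 / 2)
    (lam a b : ℕ → ℝ) (hlam : ∀ n, 0 < lam n)
    (ha : Summable (fun n => (lam n) ^ (1 + 2 * ε) * (a n) ^ 2))
    (hb : Summable (fun n => (b n) ^ 2)) :
    Tendsto (fun t : ℝ => ∑' n : ℕ,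
        ‖((-(lam n * a n * t ^ (α - 1)) : ℝ) : ℂ) *
            mittagLeffler α α ((-(lam n * t ^ α) : ℝ) : ℂ)
          + ((b n : ℝ) : ℂ) * (mittagLeffler α 1 ((-(lam n * t ^ α) : ℝ) : ℂ) - 1)‖ ^ 2)
      (nhdsWithin 0 (Set.Ioi 0)) (nhds 0)
    ∧
    ∃ C : ℝ, 0 < C ∧ ∀ t ∈ Set.Icc (0 : ℝ) T,
      ∑' n : ℕ,
        ‖((-(lam n * a n * t ^ (α - 1)) : ℝ) : ℂ) *
            mittagLeffler α α ((-(lam n * t ^ α) : ℝ) : ℂ)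
          + ((b n : ℝ) : ℂ) * mittagLeffler α 1 ((-(lam n * t ^ α) : ℝ) : ℂ)‖ ^ 2
      ≤ C * ((∑' n : ℕ, (lam n) ^ (1 + 2 * ε) * (a n) ^ 2) + ∑' n : ℕ, (b n) ^ 2) := by
  obtain ⟨M, δ, hM, hδ, hpos⟩ := exists_norm_position_term_sq_le hα1 hα2 hε1 hε2
  have hosc : ∀ n t, 0 ≤ t → |mlOscillation α (lam n ^ α⁻¹ * t)| ≤ 1 := fun n t ht =>
    abs_mlOscillation_le_one hα1 hα2 (mul_nonneg (Real.rpow_nonneg (hlam n).le _) ht)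
  have hcoef : ∀ n, 0 ≤ lam n ^ (1 + 2 * ε) * a n ^ 2 := fun n =>
    mul_nonneg (Real.rpow_nonneg (hlam n).le _) (sq_nonneg _)
  constructor
  · have hterm : ∀ n t, 0 ≤ t →
        ‖((-(lam n * a n * t ^ (α - 1)) : ℝ) : ℂ) *
            mittagLeffler α α ((-(lam n * t ^ α) : ℝ) : ℂ)
          + ((b n : ℝ) : ℂ) * (mittagLeffler α 1 ((-(lam n * t ^ α) : ℝ) : ℂ) - 1)‖ ^ 2 ≤
        2 * (M * t ^ δ * (lam n ^ (1 + 2 * ε) * a n ^ 2)) +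
          2 * (b n ^ 2 * (mlOscillation α (lam n ^ α⁻¹ * t) - 1) ^ 2) := fun n t ht => by
      refine (norm_add_sq_le_two_mul _ _).trans (add_le_add ?_ (le_of_eq ?_))
      · exact mul_le_mul_of_nonneg_left (hpos _ _ _ (hlam n) ht) zero_le_two
      · rw [mittagLeffler_one_eq_mlOscillation hα1.le (hlam n) ht, ← Complex.ofReal_one,
          ← Complex.ofReal_sub, ← Complex.ofReal_mul, Complex.norm_real, Real.norm_eq_abs,
          sq_abs, mul_pow]
    have hsum : Summable fun n =>
        2 * (M * (lam n ^ (1 + 2 * ε) * a n ^ 2)) + 2 * (b n ^ 2 * 4) :=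
      ((ha.mul_left M).mul_left 2).add ((hb.mul_right 4).mul_left 2)
    rw [show nhds (0 : ℝ) = nhds (∑' _ : ℕ, (0 : ℝ)) by rw [tsum_zero]]
    refine tendsto_tsum_of_dominated_convergence hsum (fun n => ?_) ?_
    · have h1 : Tendsto (fun t : ℝ => t ^ δ) (nhdsWithin 0 (Set.Ioi 0)) (nhds 0) := by
        have := (Real.continuous_rpow_const hδ.le).tendsto 0
        rw [Real.zero_rpow hδ.ne'] at this
        exact this.mono_left nhdsWithin_le_nhds
      have h2 : Tendsto (fun t : ℝ => mlOscillation α (lam n ^ α⁻¹ * t))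
          (nhdsWithin 0 (Set.Ioi 0)) (nhds 1) := by
        have := ((continuous_mlOscillation hα1.le).comp
          (continuous_const_mul (lam n ^ α⁻¹))).tendsto 0
        simp only [Function.comp_def, mul_zero] at this
        rw [show mlOscillation α 0 = 1 by simp [mlOscillation]] at this
        exact this.mono_left nhdsWithin_le_nhds
      have h3 := (((h1.const_mul M).mul_const (lam n ^ (1 + 2 * ε) * a n ^ 2)).const_mul 2).add
        ((((h2.sub_const 1).pow 2).const_mul (b n ^ 2)).const_mul 2)
      simp only [mul_zero, zero_mul, sub_self, ne_eq, OfNat.ofNat_ne_zero, not_false_eq_true,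
        zero_pow, add_zero] at h3
      refine squeeze_zero' (Eventually.of_forall fun t => sq_nonneg _) ?_ h3
      filter_upwards [self_mem_nhdsWithin] with t ht
      exact hterm n t (le_of_lt ht)
    · filter_upwards [Ioc_mem_nhdsGT (zero_lt_one' ℝ)] with t ht n
      rw [Real.norm_of_nonneg (sq_nonneg _)]
      refine (hterm n t ht.1.le).trans ?_
      have h1 : t ^ δ ≤ 1 := Real.rpow_le_one ht.1.le ht.2 hδ.le
      have h2 : (mlOscillation α (lam n ^ α⁻¹ * t) - 1) ^ 2 ≤ 4 := by
        have := abs_le.mp (hosc n t ht.1.le)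
        nlinarith
      have h3 : M * t ^ δ ≤ M := mul_le_of_le_one_right hM.le h1
      have := hcoef n
      gcongr
  · have hTδ : 0 < T ^ δ := Real.rpow_pos_of_pos hT δ
    refine ⟨2 * (M * T ^ δ) + 2, by positivity, fun t ht => ?_⟩
    have hterm : ∀ n,
        ‖((-(lam n * a n * t ^ (α - 1)) : ℝ) : ℂ) *
            mittagLeffler α α ((-(lam n * t ^ α) : ℝ) : ℂ)
          + ((b n : ℝ) : ℂ) * mittagLeffler α 1 ((-(lam n * t ^ α) : ℝ) : ℂ)‖ ^ 2 ≤
        (2 * (M * T ^ δ) + 2) * (lam n ^ (1 + 2 * ε) * a n ^ 2 + b n ^ 2) := fun n => by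
      have h1 := hpos (lam n) (a n) t (hlam n) ht.1
      have h2 : t ^ δ ≤ T ^ δ := Real.rpow_le_rpow ht.1 ht.2 hδ.le
      have h3 : M * t ^ δ * (lam n ^ (1 + 2 * ε) * a n ^ 2) ≤
          M * T ^ δ * (lam n ^ (1 + 2 * ε) * a n ^ 2) := by
        have := hcoef n
        gcongr
      have h4 : ‖((b n : ℝ) : ℂ) * mittagLeffler α 1 ((-(lam n * t ^ α) : ℝ) : ℂ)‖ ^ 2 ≤
          b n ^ 2 := by
        rw [mittagLeffler_one_eq_mlOscillation hα1.le (hlam n) ht.1, ← Complex.ofReal_mul,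
          Complex.norm_real, Real.norm_eq_abs, sq_abs, mul_pow]
        exact mul_le_of_le_one_right (sq_nonneg _)
          ((sq_le_one_iff_abs_le_one _).mpr (hosc n t ht.1))
      have h5 : 0 ≤ M * T ^ δ * b n ^ 2 := by positivity
      have h6 := norm_add_sq_le_two_mul
        (((-(lam n * a n * t ^ (α - 1)) : ℝ) : ℂ) * mittagLeffler α α ((-(lam n * t ^ α) : ℝ) : ℂ))
        (((b n : ℝ) : ℂ) * mittagLeffler α 1 ((-(lam n * t ^ α) : ℝ) : ℂ))
      linarith [hcoef n]
    have hsum := (ha.add hb).mul_left (2 * (M * T ^ δ) + 2)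
    rw [← ha.tsum_add hb, ← tsum_mul_left]
    exact (Summable.of_nonneg_of_le (fun n => sq_nonneg _) hterm hsum).tsum_le_tsum hterm hsum
end
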